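/- arXiv:2205.05547 — 2 statements merged into one kernel-verified Lean document; each statement's English description precedes it below -/
import Mathlib

section
/- Let γ ≥ 0. Then there exists a constant C > 0 such that for all (x,t) ∈ ℝ³ × ℝ: Σ_{k∈ℤ, k<1} |K_γ^k(x,t)| ≤ C if |(x,t)| ≤ 1, and Σ_{k∈ℤ, k<1} |K_γ^k(x,t)| ≤ C |(x,t)|^{−1} if |(x,t)| ≥ 1, where |(x,t)| denotes the Euclidean norm of (x,t) ∈ ℝ⁴; in particular the series converges. -/
open MeasureTheory Real Complex

noncomputable section

/-- `⟨ξ⟩ = √(1+|ξ|²)`. -/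
def jap (ξ : EuclideanSpace ℝ (Fin 3)) : ℝ := Real.sqrt (1 + ‖ξ‖ ^ 2)

/-- The dot product `x·ξ` on `ℝ³`. -/
def dotE (x ξ : EuclideanSpace ℝ (Fin 3)) : ℝ := ∑ i, x i * ξ i

/-- The Littlewood–Paley cutoff `χ_k(ξ) = ρ(2^{-(k+1)}|ξ|) - ρ(2^{-(k-2)}|ξ|)`. -/
def chiLP (ρ : ℝ → ℝ) (k : ℤ) (ξ : EuclideanSpace ℝ (Fin 3)) : ℝ :=
  ρ ((2 : ℝ) ^ (-(k + 1)) * ‖ξ‖) - ρ ((2 : ℝ) ^ (-(k - 2)) * ‖ξ‖)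

/-- The localized kernel `K_γ^k(x,t) = ∫ e^{ix·ξ} e^{it⟨ξ⟩} ⟨ξ⟩^{-γ} χ_k(ξ) dξ`. -/
def Kloc (ρ : ℝ → ℝ) (γ : ℝ) (k : ℤ) (x : EuclideanSpace ℝ (Fin 3)) (t : ℝ) : ℂ :=
  ∫ ξ : EuclideanSpace ℝ (Fin 3),
    Complex.exp (I * ((dotE x ξ : ℝ) + (t : ℝ) * jap ξ)) * ((jap ξ ^ (-γ) * chiLP ρ k ξ : ℝ) : ℂ)

/-- The kernel `K_γ(x,t) = Σ_{k ∈ ℤ} K_γ^k(x,t)`. -/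
def Kker (ρ : ℝ → ℝ) (γ : ℝ) (x : EuclideanSpace ℝ (Fin 3)) (t : ℝ) : ℂ :=
  ∑' k : ℤ, Kloc ρ γ k x t

/-- The Euclidean norm `|(x,t)|` of `(x,t) ∈ ℝ³ × ℝ = ℝ⁴`. -/
def xtNorm (x : EuclideanSpace ℝ (Fin 3)) (t : ℝ) : ℝ := Real.sqrt (‖x‖ ^ 2 + t ^ 2)

/-- Primitive `G(z) = ∫_z^R r F(|r|) dr`. -/
def Gp (F : ℝ → ℂ) (R z : ℝ) : ℂ := ∫ r in z..R, (r : ℂ) * F |r|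

lemma Gp_hasDerivAt {F : ℝ → ℂ} (hF : Continuous F) (R z : ℝ) :
    HasDerivAt (Gp F R) (-((z : ℂ) * F |z|)) z := by
  have hc : Continuous (fun r : ℝ => (r : ℂ) * F |r|) := by fun_prop
  exact intervalIntegral.integral_hasDerivAt_left (hc.intervalIntegrable _ _)
    (hc.stronglyMeasurableAtFilter _ _) hc.continuousAt

lemma Gp_cont {F : ℝ → ℂ} (hF : Continuous F) (R : ℝ) : Continuous (Gp F R) :=
  continuous_iff_continuousAt.2 fun z => (Gp_hasDerivAt hF R z).continuousAt

lemma Gp_neg {F : ℝ → ℂ} (hF : Continuous F) (R z : ℝ) : Gp F R (-z) = Gp F R z := by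
  have hc : Continuous (fun r : ℝ => (r : ℂ) * F |r|) := by fun_prop
  have h1 : Gp F R (-z) = (∫ r in (-z)..z, (r : ℂ) * F |r|) + Gp F R z :=
    (intervalIntegral.integral_add_adjacent_intervals
      (hc.intervalIntegrable _ _) (hc.intervalIntegrable _ _)).symm
  have h2 : (∫ r in (-z)..z, (r : ℂ) * F |r|) = - ∫ r in (-z)..z, (r : ℂ) * F |r| := by
    conv_lhs => rw [← neg_neg z]
    rw [neg_neg (-z), ← intervalIntegral.integral_comp_neg, ← intervalIntegral.integral_neg]
    simp
  have h3 : (∫ r in (-z)..z, (r : ℂ) * F |r|) = 0 := self_eq_neg.1 h2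
  rw [h1, h3, zero_add]

lemma Gp_abs {F : ℝ → ℂ} (hF : Continuous F) (R z : ℝ) : Gp F R |z| = Gp F R z := by
  rcases abs_choice z with h | h <;> rw [h]
  exact Gp_neg hF R z

lemma Gp_zero {F : ℝ → ℂ} (hF : Continuous F) {R : ℝ} (hR : 0 ≤ R)
    (hz : ∀ r, R ≤ r → F r = 0) {z : ℝ} (h : R ≤ |z|) : Gp F R z = 0 := by
  rw [← Gp_abs hF, Gp]
  rw [intervalIntegral.integral_congr (g := fun _ => (0:ℂ))]
  · simp
  · intro r hr
    rw [Set.uIcc_of_ge h] at hr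
    simp [abs_of_nonneg (hR.trans hr.1), hz r hr.1]

/-- Inner (transversal) integral. -/
lemma inner_int {F : ℝ → ℂ} (hF : Continuous F) {R : ℝ} (hR : 0 ≤ R)
    (hz : ∀ r, R ≤ r → F r = 0) (z : ℝ) (hz0 : z ≠ 0) :
    ∫ s in Set.Ioi (0:ℝ), (s : ℂ) * F (Real.sqrt (z ^ 2 + s ^ 2)) = Gp F R z := by
  have hpos : ∀ s : ℝ, 0 < z ^ 2 + s ^ 2 := fun s => by positivity
  have hd : ∀ s ∈ Set.Ici (0:ℝ), HasDerivAt (fun s : ℝ => - Gp F R (Real.sqrt (z ^ 2 + s ^ 2)))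
      ((s : ℂ) * F (Real.sqrt (z ^ 2 + s ^ 2))) s := by
    intro s _
    have h1 : HasDerivAt (fun s : ℝ => z ^ 2 + s ^ 2) (2 * s) s := by
      simpa using (hasDerivAt_pow 2 s).const_add (z ^ 2)
    have h2 := h1.sqrt (hpos s).ne'
    have h3 := ((Gp_hasDerivAt hF R _).scomp s h2).neg
    refine h3.congr_deriv ?_
    have hs : Real.sqrt (z ^ 2 + s ^ 2) ≠ 0 := (Real.sqrt_pos.2 (hpos s)).ne'
    have hs' : ((Real.sqrt (z ^ 2 + s ^ 2) : ℝ) : ℂ) ≠ 0 := by exact_mod_cast hs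
    rw [abs_of_nonneg (Real.sqrt_nonneg _), Complex.real_smul]
    push_cast
    field_simp
  have hbig : ∀ s : ℝ, R ≤ s → R ≤ Real.sqrt (z ^ 2 + s ^ 2) := by
    intro s hs
    apply Real.le_sqrt_of_sq_le
    nlinarith [sq_nonneg z]
  have hsupp : HasCompactSupport (fun s : ℝ => (s : ℂ) * F (Real.sqrt (z ^ 2 + s ^ 2))) := by
    apply HasCompactSupport.of_support_subset_isCompact (isCompact_Icc (a := -R) (b := R))
    intro s hs
    by_contra hn
    apply hs
    have : R ≤ |s| := by
      by_contra h
      exact hn (abs_le.1 (not_le.1 h).le)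
    have := hbig |s| this
    rw [sq_abs] at this
    simp [hz _ this]
  have hint : IntegrableOn (fun s : ℝ => (s : ℂ) * F (Real.sqrt (z ^ 2 + s ^ 2))) (Set.Ioi 0) :=
    (Continuous.integrable_of_hasCompactSupport (by fun_prop) hsupp).integrableOn
  have ht : Filter.Tendsto (fun s : ℝ => - Gp F R (Real.sqrt (z ^ 2 + s ^ 2))) Filter.atTop
      (nhds 0) := by
    apply tendsto_const_nhds.congr'
    filter_upwards [Filter.eventually_ge_atTop R] with s hs
    rw [Gp_zero hF hR hz, neg_zero]
    rw [abs_of_nonneg (Real.sqrt_nonneg _)]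
    exact hbig s hs
  rw [integral_Ioi_of_hasDerivAt_of_tendsto' hd hint ht]
  simp [Real.sqrt_sq_eq_abs, Gp_abs hF]

lemma inner_int2 {F : ℝ → ℂ} (hF : Continuous F) {R : ℝ} (hR : 0 ≤ R)
    (hz : ∀ r, R ≤ r → F r = 0) (z : ℝ) (hz0 : z ≠ 0) :
    ∫ y : EuclideanSpace ℝ (Fin 2), F (Real.sqrt (z ^ 2 + ‖y‖ ^ 2)) = 2 * π * Gp F R z := by
  rw [integral_fun_norm_addHaar volume (fun s => F (Real.sqrt (z ^ 2 + s ^ 2)))]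
  have h : (volume : Measure (EuclideanSpace ℝ (Fin 2))).real (Metric.ball 0 1) = π := by
    simp [Measure.real, EuclideanSpace.volume_ball_fin_two, Real.pi_pos.le]
  rw [h, ← inner_int hF hR hz z hz0]
  simp [mul_assoc]

/-- Reduction of the Fourier transform of a radial function on `ℝ³` to one dimension. -/
lemma radial_fourier {F : ℝ → ℂ} (hF : Continuous F) {R : ℝ} (hR : 0 ≤ R)
    (hz : ∀ r, R ≤ r → F r = 0) (x : EuclideanSpace ℝ (Fin 3)) :
    ∫ ξ : EuclideanSpace ℝ (Fin 3), Complex.exp (I * (dotE x ξ : ℝ)) * F ‖ξ‖ =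
      2 * π * ∫ z : ℝ, Complex.exp (I * (‖x‖ * z : ℝ)) * Gp F R z := by
  -- rotate
  set e : EuclideanSpace ℝ (Fin 3) := EuclideanSpace.single 0 ‖x‖ with he
  have hn : ‖e‖ = ‖x‖ := by simp [he]
  set U := Submodule.reflection (Submodule.span ℝ {e - x})ᗮ with hU
  have hUe : U e = x := Submodule.reflection_sub hn
  have hdot : ∀ a b : EuclideanSpace ℝ (Fin 3), dotE a b = inner ℝ a b := by
    intro a b
    simp [dotE, PiLp.inner_apply, mul_comm]
  have h1 : ∀ ξ, dotE x (U ξ) = ‖x‖ * ξ 0 := by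
    intro ξ
    rw [hdot, ← hUe, U.inner_map_map, ← hdot]
    simp [dotE, he]
  rw [← U.measurePreserving.integral_comp U.toHomeomorph.measurableEmbedding]
  simp only [h1, U.norm_map]
  -- split
  let g : EuclideanSpace ℝ (Fin 3) → ℂ := fun ξ => Complex.exp (I * (‖x‖ * ξ 0 : ℝ)) * F ‖ξ‖
  have hgc : Continuous g := by fun_prop
  have hgs : HasCompactSupport g := by
    apply HasCompactSupport.of_support_subset_isCompact (isCompact_closedBall 0 R)
    intro ξ hξ
    by_contra hn
    apply hξ
    simp only [mem_closedBall_zero_iff, not_le] at hn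
    simp [g, hz _ hn.le]
  have hgi : Integrable g := hgc.integrable_of_hasCompactSupport hgs
  let T : EuclideanSpace ℝ (Fin 3) ≃ᵐ ℝ × (Fin 2 → ℝ) :=
    (MeasurableEquiv.toLp 2 (Fin 3 → ℝ)).symm.trans
      (MeasurableEquiv.piFinSuccAbove (fun _ : Fin 3 => ℝ) 0)
  have hT : MeasurePreserving T :=
    (volume_preserving_piFinSuccAbove (fun _ : Fin 3 => ℝ) 0).comp
      (EuclideanSpace.volume_preserving_symm_measurableEquiv_toLp (Fin 3))
  have hTs : MeasurePreserving T.symm := hT.symm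
  have h2 : ∫ ξ, g ξ = ∫ p : ℝ × (Fin 2 → ℝ), g (T.symm p) :=
    (hTs.integral_comp T.symm.measurableEmbedding g).symm
  have hgi2 : Integrable (fun p : ℝ × (Fin 2 → ℝ) => g (T.symm p)) :=
    (hTs.integrable_comp_emb T.symm.measurableEmbedding).2 hgi
  have h3 : ∀ p : ℝ × (Fin 2 → ℝ), g (T.symm p) = Complex.exp (I * (‖x‖ * p.1 : ℝ)) *
      F (Real.sqrt (p.1 ^ 2 + ‖(WithLp.toLp 2 p.2 : EuclideanSpace ℝ (Fin 2))‖ ^ 2)) := by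
    intro p
    have h0 : (T.symm p) 0 = p.1 := rfl
    have h1 : (T.symm p) 1 = p.2 0 := rfl
    have h2 : (T.symm p) 2 = p.2 1 := rfl
    simp only [g, h0]
    congr 2
    rw [EuclideanSpace.norm_eq, EuclideanSpace.norm_sq_eq]
    simp only [Fin.sum_univ_three, Fin.sum_univ_two, h0, h1, h2, Real.norm_eq_abs, sq_abs]
    rw [add_assoc]
  change ∫ ξ, g ξ = _
  rw [h2, Measure.volume_eq_prod, integral_prod _ (by simpa [Measure.volume_eq_prod] using hgi2),
    ← integral_const_mul]
  apply integral_congr_ae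
  filter_upwards [compl_mem_ae_iff.2 (measure_singleton (0:ℝ))] with z hz0
  simp only [h3]
  rw [integral_const_mul]
  have h4 : ∫ y : Fin 2 → ℝ, F (Real.sqrt (z ^ 2 + ‖(WithLp.toLp 2 y : EuclideanSpace ℝ (Fin 2))‖ ^ 2))
      = 2 * π * Gp F R z := by
    rw [← inner_int2 hF hR hz z hz0]
    exact (PiLp.volume_preserving_toLp (Fin 2)).integral_comp
      (MeasurableEquiv.toLp 2 _).measurableEmbedding
      (fun y : EuclideanSpace ℝ (Fin 2) => F (Real.sqrt (z ^ 2 + ‖y‖ ^ 2)))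
  rw [h4]
  ring

lemma onedim_bounds {F : ℝ → ℂ} (hF : Continuous F) {R : ℝ} (hR : 0 ≤ R)
    (hz : ∀ r, R ≤ r → F r = 0) {M B : ℝ} (hM : ∀ r, ‖F r‖ ≤ M)
    (hB : ∀ z, 0 ≤ z → z ≤ R → ‖Gp F R z‖ ≤ B) (X : ℝ) :
    ‖∫ z : ℝ, Complex.exp (I * (X * z : ℝ)) * Gp F R z‖ ≤ B * (2 * R) ∧
    |X| * ‖∫ z : ℝ, Complex.exp (I * (X * z : ℝ)) * Gp F R z‖ ≤ R * M * (2 * R) := by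
  have hM0 : 0 ≤ M := (norm_nonneg _).trans (hM 0)
  have hexp : ∀ z : ℝ, ‖Complex.exp (I * (X * z : ℝ))‖ = 1 := by
    intro z
    rw [mul_comm, Complex.norm_exp_ofReal_mul_I]
  have hI : ∫ z : ℝ, Complex.exp (I * (X * z : ℝ)) * Gp F R z =
      ∫ z in (-R)..R, Complex.exp (I * (X * z : ℝ)) * Gp F R z := by
    symm
    apply intervalIntegral.integral_eq_integral_of_support_subset
    intro z hzs
    have : ¬ R ≤ |z| := by
      intro h
      apply hzs
      simp [Gp_zero hF hR hz h]
    have := abs_lt.1 (not_le.1 this)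
    exact ⟨this.1, this.2.le⟩
  have hlen : |R - -R| = 2 * R := by rw [abs_of_nonneg] <;> linarith
  have habs : ∀ z ∈ Set.uIoc (-R) R, |z| ≤ R := by
    intro z hz
    rw [Set.uIoc_of_le (by linarith)] at hz
    exact abs_le.2 ⟨hz.1.le, hz.2⟩
  rw [hI]
  constructor
  · rw [← hlen]
    apply intervalIntegral.norm_integral_le_of_norm_le_const
    intro z hz
    rw [norm_mul, hexp, one_mul, ← Gp_abs hF]
    exact hB _ (abs_nonneg z) (habs z hz)
  · have hu : ∀ z ∈ Set.uIcc (-R) R, HasDerivAt (Gp F R) (-((z : ℂ) * F |z|)) z :=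
      fun z _ => Gp_hasDerivAt hF R z
    have hv : ∀ z ∈ Set.uIcc (-R) R, HasDerivAt (fun z : ℝ => Complex.exp (I * (X * z : ℝ)))
        (I * X * Complex.exp (I * (X * z : ℝ))) z := by
      intro z _
      have h1 : HasDerivAt (fun z : ℝ => I * ((X * z : ℝ) : ℂ)) (I * X) z := by
        have := (((hasDerivAt_id z).const_mul X).ofReal_comp).const_mul I
        simpa using this
      have := h1.cexp
      rwa [mul_comm] at this
    have hibp := intervalIntegral.integral_mul_deriv_eq_deriv_mul hu hv
      (Continuous.intervalIntegrable (by fun_prop) _ _)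
      (Continuous.intervalIntegrable (by fun_prop) _ _)
    rw [Gp_zero hF hR hz (by rw [abs_of_nonneg hR]),
      Gp_zero hF hR hz (by rw [abs_neg, abs_of_nonneg hR])] at hibp
    have h2 : (∫ z in (-R)..R, Gp F R z * (I * X * Complex.exp (I * (X * z : ℝ)))) =
        I * X * ∫ z in (-R)..R, Complex.exp (I * (X * z : ℝ)) * Gp F R z := by
      rw [← intervalIntegral.integral_const_mul]
      congr 1
      ext z
      ring
    have h3 : |X| * ‖∫ z in (-R)..R, Complex.exp (I * (X * z : ℝ)) * Gp F R z‖ =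
        ‖∫ z in (-R)..R, -((z : ℂ) * F |z|) * Complex.exp (I * (X * z : ℝ))‖ := by
      rw [h2] at hibp
      have := congrArg norm hibp
      simpa using this
    rw [h3, ← hlen]
    apply intervalIntegral.norm_integral_le_of_norm_le_const
    intro z hz
    rw [norm_mul, hexp, mul_one, norm_neg, norm_mul, Complex.norm_real, Real.norm_eq_abs]
    exact mul_le_mul (habs z hz) (hM _) (norm_nonneg _) hR

/-- Radial profile. -/
def Fprof (ρ : ℝ → ℝ) (γ a t r : ℝ) : ℂ :=
  Complex.exp (I * (t * Real.sqrt (1 + r ^ 2) : ℝ)) *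
    ((Real.sqrt (1 + r ^ 2) ^ (-γ) * (ρ (a * r) - ρ (8 * a * r)) : ℝ) : ℂ)

def pw (γ r : ℝ) : ℝ := Real.sqrt (1 + r ^ 2) * Real.sqrt (1 + r ^ 2) ^ (-γ)

lemma jpos (r : ℝ) : 0 < Real.sqrt (1 + r ^ 2) := Real.sqrt_pos.2 (by positivity)

lemma jdiff : ContDiff ℝ 1 (fun r : ℝ => Real.sqrt (1 + r ^ 2)) :=
  ContDiff.sqrt (by fun_prop) (fun r => by positivity)

lemma pw_diff (γ : ℝ) : ContDiff ℝ 1 (pw γ) :=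
  jdiff.mul (jdiff.rpow_const_of_ne fun r => (jpos r).ne')

lemma Fprof_cont {ρ : ℝ → ℝ} (hρ : Continuous ρ) (γ a t : ℝ) : Continuous (Fprof ρ γ a t) := by
  have h1 : Continuous (fun r : ℝ => Real.sqrt (1 + r ^ 2) ^ (-γ)) :=
    Continuous.rpow_const (by fun_prop) (fun r => Or.inl (jpos r).ne')
  unfold Fprof
  fun_prop

lemma Fprof_norm {ρ : ℝ → ℝ} {γ : ℝ} (hγ : 0 ≤ γ) {M : ℝ} (hM : ∀ r, |ρ r| ≤ M) (a t r : ℝ) :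
    ‖Fprof ρ γ a t r‖ ≤ 2 * M := by
  rw [Fprof, norm_mul, mul_comm I, Complex.norm_exp_ofReal_mul_I, one_mul, Complex.norm_real,
    norm_mul, Real.norm_eq_abs, Real.norm_eq_abs]
  have h1 : |Real.sqrt (1 + r ^ 2) ^ (-γ)| ≤ 1 := by
    rw [abs_of_nonneg (by positivity)]
    apply Real.rpow_le_one_of_one_le_of_nonpos _ (by linarith)
    rw [Real.one_le_sqrt]
    nlinarith [sq_nonneg r]
  have h2 : |ρ (a * r) - ρ (8 * a * r)| ≤ 2 * M := by
    have := abs_sub (ρ (a * r)) (ρ (8 * a * r))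
    linarith [hM (a * r), hM (8 * a * r)]
  calc _ ≤ 1 * (2 * M) := mul_le_mul h1 h2 (abs_nonneg _) zero_le_one
    _ = _ := one_mul _

lemma Fprof_zero {ρ : ℝ → ℝ} (hz : ∀ r, 2 ≤ r → ρ r = 0) (γ : ℝ) {a : ℝ} (ha : 0 < a) (t r : ℝ)
    (h : 2 / a ≤ r) : Fprof ρ γ a t r = 0 := by
  have h1 : 2 ≤ a * r := by rwa [div_le_iff₀ ha, mul_comm] at h
  simp [Fprof, hz _ h1, hz (8 * a * r) (by linarith)]

lemma G_t_bound {ρ : ℝ → ℝ} (hρ : ContDiff ℝ 1 ρ) (hz : ∀ r, 2 ≤ r → ρ r = 0) (γ : ℝ)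
    {M M' P P' : ℝ} (hM : ∀ r, |ρ r| ≤ M) (hM' : ∀ r, |deriv ρ r| ≤ M')
    (hP : ∀ r, 0 ≤ r → r ≤ 4 → |pw γ r| ≤ P) (hP' : ∀ r, 0 ≤ r → r ≤ 4 → |deriv (pw γ) r| ≤ P')
    {a : ℝ} (ha : 1 / 2 ≤ a) (t : ℝ) {z : ℝ} (hz0 : 0 ≤ z) (hzR : z ≤ 2 / a) :
    |t| * ‖Gp (Fprof ρ γ a t) (2 / a) z‖ ≤ P * (2 * M) + (8 * P' * M + 18 * P * M') := by
  have ha0 : 0 < a := by linarith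
  have hR4 : 2 / a ≤ 4 := by rw [div_le_iff₀ ha0]; linarith
  have hM0 : 0 ≤ M := (abs_nonneg _).trans (hM 0)
  have hM0' : 0 ≤ M' := (abs_nonneg _).trans (hM' 0)
  have hP0 : 0 ≤ P := (abs_nonneg _).trans (hP 0 le_rfl (by norm_num))
  have hP0' : 0 ≤ P' := (abs_nonneg _).trans (hP' 0 le_rfl (by norm_num))
  have hρd : ∀ r, HasDerivAt ρ (deriv ρ r) r :=
    fun r => (hρ.differentiable (by norm_num)).differentiableAt.hasDerivAt
  have hpd : ∀ r, HasDerivAt (pw γ) (deriv (pw γ) r) r :=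
    fun r => ((pw_diff γ).differentiable (by norm_num)).differentiableAt.hasDerivAt
  have hρ'c : Continuous (deriv ρ) := hρ.continuous_deriv le_rfl
  have hp'c : Continuous (deriv (pw γ)) := (pw_diff γ).continuous_deriv le_rfl
  have hpc : Continuous (pw γ) := (pw_diff γ).continuous
  have hρc : Continuous ρ := hρ.continuous
  set χ : ℝ → ℝ := fun r => ρ (a * r) - ρ (8 * a * r) with hχ
  set χ' : ℝ → ℝ := fun r => deriv ρ (a * r) * a - deriv ρ (8 * a * r) * (8 * a) with hχ'
  have hχd : ∀ r, HasDerivAt χ (χ' r) r := by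
    intro r
    have h1 : HasDerivAt (fun r => a * r) a r := by simpa using (hasDerivAt_id r).const_mul a
    have h2 : HasDerivAt (fun r => 8 * a * r) (8 * a) r := by
      simpa using (hasDerivAt_id r).const_mul (8 * a)
    exact ((hρd (a * r)).comp r h1).sub ((hρd (8 * a * r)).comp r h2)
  have hχb : ∀ r, |χ r| ≤ 2 * M := by
    intro r
    have := abs_sub (ρ (a * r)) (ρ (8 * a * r))
    have h1 := hM (a * r)
    have h2 := hM (8 * a * r)
    simp only [hχ]
    linarith
  have hχb' : ∀ r, |χ' r| ≤ 9 * a * M' := by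
    intro r
    have := abs_sub (deriv ρ (a * r) * a) (deriv ρ (8 * a * r) * (8 * a))
    rw [abs_mul, abs_mul, abs_of_pos ha0, abs_of_pos (by linarith : 0 < 8 * a)] at this
    have h1 := mul_le_mul_of_nonneg_right (hM' (a * r)) ha0.le
    have h2 := mul_le_mul_of_nonneg_right (hM' (8 * a * r)) (by linarith : 0 ≤ 8 * a)
    simp only [hχ']
    linarith
  have hχR : χ (2 / a) = 0 := by
    have : a * (2 / a) = 2 := by field_simp
    simp only [hχ]
    rw [mul_assoc, this, hz 2 le_rfl, hz (8 * 2) (by norm_num), sub_zero]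
  let c : ℝ → ℂ := fun r => ((pw γ r * χ r : ℝ) : ℂ)
  let c' : ℝ → ℂ := fun r => ((deriv (pw γ) r * χ r + pw γ r * χ' r : ℝ) : ℂ)
  let v : ℝ → ℂ := fun r => Complex.exp (I * (t * Real.sqrt (1 + r ^ 2) : ℝ))
  have hvn : ∀ r, ‖v r‖ = 1 := by
    intro r
    simp only [v]
    rw [mul_comm, Complex.norm_exp_ofReal_mul_I]
  let v' : ℝ → ℂ := fun r => I * (t * (r / Real.sqrt (1 + r ^ 2)) : ℝ) * v r
  have hc : ∀ r ∈ Set.uIcc z (2 / a), HasDerivAt c (c' r) r :=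
    fun r _ => ((hpd r).mul (hχd r)).ofReal_comp
  have hv : ∀ r ∈ Set.uIcc z (2 / a), HasDerivAt v (v' r) r := by
    intro r _
    have h1 : HasDerivAt (fun s : ℝ => 1 + s ^ 2) (2 * r) r := by
      simpa using (hasDerivAt_pow 2 r).const_add 1
    have h2 := h1.sqrt (by positivity)
    have h3 := (((h2.const_mul t).ofReal_comp).const_mul I).cexp
    refine h3.congr_deriv ?_
    simp only [v', v]
    rw [mul_comm]
    congr 4
    rw [mul_div_mul_left _ _ two_ne_zero]
  have hχc : Continuous χ := by fun_prop
  have hχc' : Continuous χ' := by fun_prop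
  have hcc' : Continuous c' := by fun_prop
  have hvc : Continuous v := by fun_prop
  have hvc' : Continuous v' := by
    have : Continuous (fun r : ℝ => r / Real.sqrt (1 + r ^ 2)) :=
      Continuous.div continuous_id (by fun_prop) (fun r => (jpos r).ne')
    fun_prop
  have hibp := intervalIntegral.integral_mul_deriv_eq_deriv_mul hc hv
    (hcc'.intervalIntegrable _ _) (hvc'.intervalIntegrable _ _)
  have hcR : c (2 / a) = 0 := by simp [c, hχR]
  have h2 : (∫ r in z..(2 / a), c r * v' r) = I * t * Gp (Fprof ρ γ a t) (2 / a) z := by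
    rw [Gp, ← intervalIntegral.integral_const_mul]
    apply intervalIntegral.integral_congr
    intro r hr
    rw [Set.uIcc_of_le hzR] at hr
    have hr0 : 0 ≤ r := hz0.trans hr.1
    have hj : ((Real.sqrt (1 + r ^ 2) : ℝ) : ℂ) ≠ 0 := by exact_mod_cast (jpos r).ne'
    simp only [c, v', v, Fprof, pw, hχ, abs_of_nonneg hr0]
    rw [show (Real.sqrt (1 + r ^ 2) * Real.sqrt (1 + r ^ 2) ^ (-γ) * (ρ (a * r) - ρ (8 * a * r)))
      = Real.sqrt (1 + r ^ 2) * (Real.sqrt (1 + r ^ 2) ^ (-γ) * (ρ (a * r) - ρ (8 * a * r))) by ring,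
      Complex.ofReal_mul (Real.sqrt (1 + r ^ 2)), Complex.ofReal_mul t, Complex.ofReal_div]
    field_simp
  rw [h2, hcR, zero_mul, zero_sub] at hibp
  have h3 := congrArg norm hibp
  rw [norm_mul, norm_mul, Complex.norm_I, one_mul, Complex.norm_real, Real.norm_eq_abs] at h3
  rw [h3]
  refine (norm_sub_le _ _).trans (add_le_add ?_ ?_)
  · rw [norm_neg, norm_mul, hvn, mul_one, Complex.norm_real, Real.norm_eq_abs, abs_mul]
    exact mul_le_mul (hP z hz0 (hzR.trans hR4)) (hχb z) (abs_nonneg _) hP0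
  · have h4 : ‖∫ r in z..(2 / a), c' r * v r‖ ≤ (P' * (2 * M) + P * (9 * a * M')) * |2 / a - z| := by
      apply intervalIntegral.norm_integral_le_of_norm_le_const
      intro r hr
      rw [Set.uIoc_of_le hzR] at hr
      have hr0 : 0 ≤ r := hz0.trans hr.1.le
      have hr4 : r ≤ 4 := hr.2.trans hR4
      rw [norm_mul, hvn, mul_one, Complex.norm_real, Real.norm_eq_abs]
      refine (abs_add_le _ _).trans (add_le_add ?_ ?_)
      · rw [abs_mul]; exact mul_le_mul (hP' r hr0 hr4) (hχb r) (abs_nonneg _) hP0'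
      · rw [abs_mul]; exact mul_le_mul (hP r hr0 hr4) (hχb' r) (abs_nonneg _) hP0
    refine h4.trans ?_
    rw [abs_of_nonneg (by linarith)]
    calc (P' * (2 * M) + P * (9 * a * M')) * (2 / a - z)
        ≤ (P' * (2 * M) + P * (9 * a * M')) * (2 / a) := by
          apply mul_le_mul_of_nonneg_left (by linarith); positivity
      _ = P' * (2 * M) * (2 / a) + 18 * P * M' := by field_simp; ring
      _ ≤ P' * (2 * M) * 4 + 18 * P * M' := by gcongr
      _ = _ := by ring

lemma G_bound {F : ℝ → ℂ} {M R : ℝ} (hR : 0 ≤ R) (hR4 : R ≤ 4) (hM : ∀ r, ‖F r‖ ≤ M)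
    {z : ℝ} (hz0 : 0 ≤ z) (hzR : z ≤ R) : ‖Gp F R z‖ ≤ 16 * M := by
  have hM0 : 0 ≤ M := (norm_nonneg _).trans (hM 0)
  have h : ‖Gp F R z‖ ≤ (4 * M) * |R - z| := by
    apply intervalIntegral.norm_integral_le_of_norm_le_const
    intro r hr
    rw [Set.uIoc_of_le hzR] at hr
    rw [norm_mul, Complex.norm_real, Real.norm_eq_abs, abs_of_nonneg (hz0.trans hr.1.le)]
    exact mul_le_mul (hr.2.trans hR4) (hM _) (norm_nonneg _) (by norm_num)
  refine h.trans ?_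
  rw [abs_of_nonneg (by linarith)]
  nlinarith

lemma Kloc_eq (ρ : ℝ → ℝ) (γ : ℝ) (k : ℤ) (x : EuclideanSpace ℝ (Fin 3)) (t : ℝ) :
    Kloc ρ γ k x t = ∫ ξ : EuclideanSpace ℝ (Fin 3),
      Complex.exp (I * (dotE x ξ : ℝ)) * Fprof ρ γ ((2:ℝ) ^ (-(k + 1))) t ‖ξ‖ := by
  unfold Kloc
  congr 1
  ext ξ
  have h8 : (2:ℝ) ^ (-(k - 2)) = 8 * (2:ℝ) ^ (-(k + 1)) := by
    rw [show -(k - 2) = 3 + -(k + 1) by ring, zpow_add₀ two_ne_zero]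
    norm_num
  rw [Fprof, ← mul_assoc, ← Complex.exp_add, chiLP, jap, h8]
  congr 2
  push_cast
  ring

lemma Kloc_bound (γ : ℝ) (hγ : 0 ≤ γ) (ρ : ℝ → ℝ)
    (hρ : ContDiff ℝ (⊤ : ℕ∞) ρ) (hρsupp : Function.support ρ ⊆ Set.Ioo (-2) 2) :
    ∃ C : ℝ, 0 < C ∧ ∀ (x : EuclideanSpace ℝ (Fin 3)) (t : ℝ) (k : ℤ), k < 1 →
      ‖Kloc ρ γ k x t‖ ≤ C * (2:ℝ) ^ k ∧ xtNorm x t * ‖Kloc ρ γ k x t‖ ≤ C * (2:ℝ) ^ k := by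
  have hρ1 : ContDiff ℝ 1 ρ := hρ.of_le (by exact_mod_cast le_top)
  have hcs : HasCompactSupport ρ :=
    HasCompactSupport.of_support_subset_isCompact (isCompact_Icc (a := (-2:ℝ)) (b := 2))
      (hρsupp.trans Set.Ioo_subset_Icc_self)
  have hz : ∀ r, 2 ≤ r → ρ r = 0 := by
    intro r hr
    by_contra h
    have := (hρsupp h).2
    linarith
  obtain ⟨M, hM⟩ := hcs.exists_bound_of_continuous hρ1.continuous
  obtain ⟨M', hM'⟩ := hcs.deriv.exists_bound_of_continuous (hρ1.continuous_deriv le_rfl)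
  obtain ⟨P, hP⟩ := (isCompact_Icc (a := (0:ℝ)) (b := 4)).exists_bound_of_continuousOn
    (pw_diff γ).continuous.continuousOn
  obtain ⟨P', hP'⟩ := (isCompact_Icc (a := (0:ℝ)) (b := 4)).exists_bound_of_continuousOn
    ((pw_diff γ).continuous_deriv le_rfl).continuousOn
  have hM0 : 0 ≤ M := (norm_nonneg _).trans (hM 0)
  set D : ℝ := P * (2 * M) + (8 * P' * M + 18 * P * M') with hD
  set B : ℝ := |D| + 32 * M + 1 with hB
  have hBpos : 0 < B := by positivity
  refine ⟨2 * π * (B * 16), by positivity, ?_⟩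
  intro x t k hk
  set a : ℝ := (2:ℝ) ^ (-(k + 1)) with ha
  have ha0 : 0 < a := by positivity
  have ha2 : 1 / 2 ≤ a := by
    have : (2:ℝ) ^ (-1 : ℤ) ≤ a := zpow_le_zpow_right₀ (by norm_num) (by omega)
    norm_num at this
    linarith
  have hRk : 2 / a = 4 * (2:ℝ) ^ k := by
    rw [ha, zpow_neg, div_inv_eq_mul, zpow_add₀ two_ne_zero]
    norm_num
    ring
  have hR0 : 0 ≤ 2 / a := by positivity
  have hR4 : 2 / a ≤ 4 := by rw [div_le_iff₀ ha0]; linarith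
  have hFc := Fprof_cont hρ1.continuous γ a t
  have hFz : ∀ r, 2 / a ≤ r → Fprof ρ γ a t r = 0 := fun r h => Fprof_zero hz γ ha0 t r h
  have hFn : ∀ r, ‖Fprof ρ γ a t r‖ ≤ 2 * M := Fprof_norm hγ hM a t
  have hG1 : ∀ z, 0 ≤ z → z ≤ 2 / a → ‖Gp (Fprof ρ γ a t) (2 / a) z‖ ≤ B := by
    intro z h0 h1
    have := G_bound hR0 hR4 hFn h0 h1
    have := abs_nonneg D
    linarith
  have hG2 : ∀ z, 0 ≤ z → z ≤ 2 / a → |t| * ‖Gp (Fprof ρ γ a t) (2 / a) z‖ ≤ B := by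
    intro z h0 h1
    have := G_t_bound hρ1 hz γ hM hM' (fun r h h' => hP r ⟨h, h'⟩)
      (fun r h h' => hP' r ⟨h, h'⟩) ha2 t h0 h1
    have := le_abs_self D
    linarith
  rw [Kloc_eq, radial_fourier hFc hR0 hFz x, norm_mul]
  have hpi : ‖(2 * π : ℂ)‖ = 2 * π := by
    rw [norm_mul, Complex.norm_real, Real.norm_eq_abs, abs_of_pos Real.pi_pos]
    simp
  rw [hpi]
  have hb1 := (onedim_bounds hFc hR0 hFz hFn hG1 ‖x‖).1
  have hbx := (onedim_bounds hFc hR0 hFz hFn hG1 ‖x‖).2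
  have hbt : |t| * ‖∫ z : ℝ, Complex.exp (I * (‖x‖ * z : ℝ)) * Gp (Fprof ρ γ a t) (2 / a) z‖ ≤
      B * (2 * (2 / a)) := by
    rcases eq_or_ne t 0 with ht | ht
    · rw [ht, abs_zero, zero_mul]; positivity
    · have htp : 0 < |t| := abs_pos.2 ht
      have := (onedim_bounds hFc hR0 hFz hFn (B := B / |t|)
        (fun z h0 h1 => by rw [le_div_iff₀ htp, mul_comm]; exact hG2 z h0 h1) ‖x‖).1
      calc _ ≤ |t| * (B / |t| * (2 * (2 / a))) := mul_le_mul_of_nonneg_left this htp.le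
        _ = _ := by field_simp
  generalize ‖∫ z : ℝ, Complex.exp (I * (‖x‖ * z : ℝ)) * Gp (Fprof ρ γ a t) (2 / a) z‖ = Q
    at hb1 hbx hbt ⊢
  rw [abs_of_nonneg (norm_nonneg x)] at hbx
  have hx2 : ‖x‖ * Q ≤ B * (2 * (2 / a)) := by
    refine hbx.trans ?_
    apply mul_le_mul_of_nonneg_right _ (by positivity)
    have : 2 / a * (2 * M) ≤ 4 * (2 * M) := mul_le_mul_of_nonneg_right hR4 (by linarith)
    have := abs_nonneg D
    linarith
  rw [hRk] at hb1 hx2 hbt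
  have hk0 : 0 < (2:ℝ) ^ k := by positivity
  have hBk : 0 < B * (2:ℝ) ^ k := by positivity
  have hpi0 : 0 ≤ 2 * π := by positivity
  constructor
  · rw [mul_assoc (2 * π) (B * 16)]
    apply mul_le_mul_of_nonneg_left _ hpi0
    linarith
  · rcases lt_or_ge Q 0 with hQ | hQ
    · have : xtNorm x t * (2 * π * Q) ≤ 0 := by
        apply mul_nonpos_of_nonneg_of_nonpos (Real.sqrt_nonneg _)
        exact mul_nonpos_of_nonneg_of_nonpos hpi0 hQ.le
      refine this.trans ?_
      positivity
    have hN : xtNorm x t ≤ ‖x‖ + |t| := by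
      rw [xtNorm]
      apply Real.sqrt_le_iff.2 ⟨by positivity, ?_⟩
      rw [add_sq, sq_abs]
      have : 0 ≤ 2 * ‖x‖ * |t| := by positivity
      linarith
    rw [mul_left_comm, mul_assoc (2 * π) (B * 16)]
    apply mul_le_mul_of_nonneg_left _ hpi0
    have := mul_le_mul_of_nonneg_right hN hQ
    linarith

def negEquiv : ℕ ≃ {k : ℤ // k < 1} where
  toFun n := ⟨-(n : ℤ), by omega⟩
  invFun k := (-k.1).toNat
  left_inv n := by simp
  right_inv k := by
    have := k.2
    ext
    simp only
    omega

lemma summable_two_zpow : Summable (fun k : {k : ℤ // k < 1} => (2:ℝ) ^ (k : ℤ)) := by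
  rw [← negEquiv.summable_iff]
  refine (summable_geometric_two).congr ?_
  intro n
  simp [negEquiv]

theorem Kloc_sum_low (γ : ℝ) (hγ : 0 ≤ γ) (ρ : ℝ → ℝ)
    (hρ : ContDiff ℝ (⊤ : ℕ∞) ρ) (hρsupp : Function.support ρ ⊆ Set.Ioo (-2) 2)
    (hρ1 : ∀ s : ℝ, |s| ≤ 1 → ρ s = 1) :
    ∃ C : ℝ, 0 < C ∧ ∀ (x : EuclideanSpace ℝ (Fin 3)) (t : ℝ),
      Summable (fun k : {k : ℤ // k < 1} => ‖Kloc ρ γ k x t‖) ∧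
      (xtNorm x t ≤ 1 → ∑' k : {k : ℤ // k < 1}, ‖Kloc ρ γ k x t‖ ≤ C) ∧
      (1 ≤ xtNorm x t →
        ∑' k : {k : ℤ // k < 1}, ‖Kloc ρ γ k x t‖ ≤ C * (xtNorm x t)⁻¹) := by
  obtain ⟨C, hC, hK⟩ := Kloc_bound γ hγ ρ hρ hρsupp
  have hs := summable_two_zpow
  set S : ℝ := ∑' k : {k : ℤ // k < 1}, (2:ℝ) ^ (k : ℤ) with hS
  have hS0 : 0 ≤ S := tsum_nonneg fun k => by positivity
  refine ⟨C * S + 1, by positivity, ?_⟩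
  intro x t
  have hsum : Summable (fun k : {k : ℤ // k < 1} => ‖Kloc ρ γ k x t‖) :=
    Summable.of_nonneg_of_le (fun k => norm_nonneg _) (fun k => (hK x t k k.2).1) (hs.mul_left C)
  refine ⟨hsum, fun _ => ?_, fun h1 => ?_⟩
  · have := hsum.tsum_le_tsum (fun k : {k : ℤ // k < 1} => (hK x t k k.2).1) (hs.mul_left C)
    rw [tsum_mul_left] at this
    linarith
  · have hpos : 0 < xtNorm x t := by linarith
    rw [← div_eq_mul_inv, le_div_iff₀ hpos, mul_comm, ← tsum_mul_left]
    have := (hsum.mul_left (xtNorm x t)).tsum_le_tsum (fun k : {k : ℤ // k < 1} => (hK x t k k.2).2) (hs.mul_left C)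
    rw [tsum_mul_left (a := C)] at this
    linarith

end
end

section
/- Let γ ≥ 0. Then there exists a constant C > 0 such that for all k ∈ ℤ with k ≤ 1 and all (x,t) ∈ ℝ³ × ℝ: |K_γ^k(x,t)| ≤ C 2^{3k} (1 + 2^{2k}|(x,t)|)^{−3/2}, where |(x,t)| denotes the Euclidean norm of (x,t) ∈ ℝ⁴. -/
open MeasureTheory Real Complex

noncomputable section

theorem vdc_norm_exp (y : ℝ) : ‖Complex.exp (I * (y : ℂ))‖ = 1 := by
  rw [mul_comm]; exact Complex.norm_exp_ofReal_mul_I y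

theorem vdc_hasDeriv {ψ : ℝ → ℝ} {d x : ℝ} (h : HasDerivAt ψ d x) :
    HasDerivAt (fun y => Complex.exp (I * (ψ y : ℂ))) (Complex.exp (I * (ψ x : ℂ)) * (I * (d : ℂ))) x :=
  (h.ofReal_comp.const_mul I).cexp

/-- First derivative van der Corput estimate. -/
theorem vdc_one (ψ ψ1 ψ2 : ℝ → ℝ) (h1 : ∀ x, HasDerivAt ψ (ψ1 x) x)
    (h2 : ∀ x, HasDerivAt ψ1 (ψ2 x) x) (hc : Continuous ψ2) (a b μ : ℝ) (hab : a ≤ b) (hμ : 0 < μ)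
    (hpos : ∀ x ∈ Set.Icc a b, 0 ≤ ψ2 x) (hlow : ∀ x ∈ Set.Icc a b, μ ≤ |ψ1 x|) :
    ‖∫ x in a..b, Complex.exp (I * (ψ x : ℂ))‖ ≤ 4 / μ := by
  have c1 : Continuous ψ1 := continuous_iff_continuousAt.2 fun x => (h2 x).continuousAt
  have c0 : Continuous ψ := continuous_iff_continuousAt.2 fun x => (h1 x).continuousAt
  have hne : ∀ x ∈ Set.Icc a b, ψ1 x ≠ 0 := by
    intro x hx h0
    have := hlow x hx
    rw [h0, abs_zero] at this
    linarith
  have hinv : ∀ x ∈ Set.Icc a b, HasDerivAt (fun y => (ψ1 y)⁻¹) (-ψ2 x / ψ1 x ^ 2) x :=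
    fun x hx => (h2 x).inv (hne x hx)
  have hinvbd : ∀ x ∈ Set.Icc a b, |(ψ1 x)⁻¹| ≤ 1 / μ := by
    intro x hx
    rw [abs_inv, ← one_div]
    exact one_div_le_one_div_of_le hμ (hlow x hx)
  have hcont : ContinuousOn (fun x => -ψ2 x / ψ1 x ^ 2) (Set.Icc a b) := by
    apply ContinuousOn.div (by fun_prop) (by fun_prop)
    intro x hx
    exact pow_ne_zero _ (hne x hx)
  have hinteg : IntervalIntegrable (fun x => -ψ2 x / ψ1 x ^ 2) volume a b := by
    apply ContinuousOn.intervalIntegrable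
    rwa [Set.uIcc_of_le hab]
  have key : (∫ x in a..b, Complex.exp (I * (ψ x : ℂ))) =
      -I * ∫ x in a..b, (((ψ1 x)⁻¹ : ℝ) : ℂ) * (Complex.exp (I * (ψ x : ℂ)) * (I * (ψ1 x : ℂ))) := by
    rw [← intervalIntegral.integral_const_mul]
    apply intervalIntegral.integral_congr
    intro x hx
    rw [Set.uIcc_of_le hab] at hx
    have : (ψ1 x : ℂ) ≠ 0 := by exact_mod_cast hne x hx
    have hI := Complex.I_mul_I
    simp only
    push_cast
    field_simp
    rw [Complex.I_sq]; ring
  rw [key, intervalIntegral.integral_mul_deriv_eq_deriv_mul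
    (u := fun x => (((ψ1 x)⁻¹ : ℝ) : ℂ)) (u' := fun x => ((-ψ2 x / ψ1 x ^ 2 : ℝ) : ℂ))
    (v := fun x => Complex.exp (I * (ψ x : ℂ)))]
  rotate_left
  · intro x hx
    rw [Set.uIcc_of_le hab] at hx
    exact (hinv x hx).ofReal_comp
  · intro x hx
    exact vdc_hasDeriv (h1 x)
  · exact ContinuousOn.intervalIntegrable (by
      rw [Set.uIcc_of_le hab]
      exact Complex.continuous_ofReal.comp_continuousOn hcont)
  · apply Continuous.intervalIntegrable
    fun_prop
  have e3 : ‖∫ x in a..b, ((-ψ2 x / ψ1 x ^ 2 : ℝ) : ℂ) * Complex.exp (I * (ψ x : ℂ))‖ ≤ 2 / μ := by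
    have := intervalIntegral.norm_integral_le_of_norm_le (μ := volume) (a := a) (b := b)
      (f := fun x => ((-ψ2 x / ψ1 x ^ 2 : ℝ) : ℂ) * Complex.exp (I * (ψ x : ℂ)))
      (g := fun x => -(-ψ2 x / ψ1 x ^ 2)) hab (by
        filter_upwards with x hx
        have hx' : x ∈ Set.Icc a b := ⟨hx.1.le, hx.2⟩
        rw [norm_mul, vdc_norm_exp, mul_one, Complex.norm_real, Real.norm_eq_abs, abs_of_nonpos]
        exact div_nonpos_of_nonpos_of_nonneg (by linarith [hpos x hx']) (sq_nonneg _)) hinteg.neg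
    refine this.trans ?_
    rw [intervalIntegral.integral_neg, intervalIntegral.integral_eq_sub_of_hasDerivAt
      (f := fun y => (ψ1 y)⁻¹) (by rwa [Set.uIcc_of_le hab]) hinteg]
    have ha := abs_le.1 (hinvbd a ⟨le_rfl, hab⟩)
    have hb := abs_le.1 (hinvbd b ⟨hab, le_rfl⟩)
    have : 2 / μ = 1 / μ + 1 / μ := by ring
    linarith [ha.1, ha.2, hb.1, hb.2]
  have ha := hinvbd a ⟨le_rfl, hab⟩
  have hb := hinvbd b ⟨hab, le_rfl⟩
  rw [norm_mul, norm_neg, Complex.norm_I, one_mul]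
  refine (norm_sub_le _ _).trans ?_
  have e12 := norm_sub_le ((((ψ1 b)⁻¹ : ℝ) : ℂ) * Complex.exp (I * (ψ b : ℂ)))
    ((((ψ1 a)⁻¹ : ℝ) : ℂ) * Complex.exp (I * (ψ a : ℂ)))
  simp only [norm_mul, vdc_norm_exp, mul_one, Complex.norm_real, Real.norm_eq_abs] at e12
  have : 4 / μ = 1 / μ + 1 / μ + 2 / μ := by ring
  linarith

/-- Second derivative van der Corput estimate. -/
theorem vdc_two (ψ ψ1 ψ2 : ℝ → ℝ) (h1 : ∀ x, HasDerivAt ψ (ψ1 x) x)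
    (h2 : ∀ x, HasDerivAt ψ1 (ψ2 x) x) (hc : Continuous ψ2) (a b μ : ℝ) (hab : a ≤ b) (hμ : 0 < μ)
    (hlow : ∀ x ∈ Set.Icc a b, μ ≤ ψ2 x) :
    ‖∫ x in a..b, Complex.exp (I * (ψ x : ℂ))‖ ≤ 10 / √μ := by
  have c1 : Continuous ψ1 := continuous_iff_continuousAt.2 fun x => (h2 x).continuousAt
  have c0 : Continuous ψ := continuous_iff_continuousAt.2 fun x => (h1 x).continuousAt
  have hs : 0 < √μ := Real.sqrt_pos.2 hμ
  have hss : √μ * √μ = μ := Real.mul_self_sqrt hμ.le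
  set δ := 1 / √μ with hδ
  have hδ0 : 0 < δ := by positivity
  have hμδ : μ * δ = √μ := by rw [hδ]; field_simp; nlinarith
  have mono : ∀ x ∈ Set.Icc a b, ∀ y ∈ Set.Icc a b, x ≤ y → μ * (y - x) ≤ ψ1 y - ψ1 x := by
    intro x hx y hy hxy
    have hm : MonotoneOn (fun z => ψ1 z - μ * z) (Set.Icc a b) := by
      apply monotoneOn_of_deriv_nonneg (convex_Icc a b) (by fun_prop)
      · intro z hz
        exact ((h2 z).sub ((hasDerivAt_id z).const_mul μ)).differentiableAt.differentiableWithinAt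
      · intro z hz
        have : HasDerivAt (fun z => ψ1 z - μ * z) (ψ2 z - μ * 1) z :=
          (h2 z).sub ((hasDerivAt_id z).const_mul μ)
        rw [this.deriv]
        linarith [hlow z (interior_subset hz)]
    have := hm hx hy hxy
    simp only at this
    linarith
  obtain ⟨c, hcm, hcl, hcr⟩ : ∃ c ∈ Set.Icc a b, (∀ x ∈ Set.Icc a b, x ≤ c - δ → ψ1 x ≤ -√μ) ∧
      (∀ x ∈ Set.Icc a b, c + δ ≤ x → √μ ≤ ψ1 x) := by
    have ham : a ∈ Set.Icc a b := ⟨le_rfl, hab⟩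
    have hbm : b ∈ Set.Icc a b := ⟨hab, le_rfl⟩
    rcases le_total 0 (ψ1 a) with h | h
    · refine ⟨a, ham, fun x hx hx' => ?_, fun x hx hx' => ?_⟩
      · linarith [hx.1]
      · have := mono a ham x hx hx.1
        nlinarith
    rcases le_total (ψ1 b) 0 with h' | h'
    · refine ⟨b, hbm, fun x hx hx' => ?_, fun x hx hx' => ?_⟩
      · have := mono x hx b hbm hx.2
        nlinarith
      · linarith [hx.2]
    obtain ⟨c, hcm, hc0⟩ := intermediate_value_Icc hab c1.continuousOn (show (0:ℝ) ∈ Set.Icc _ _ from ⟨h, h'⟩)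
    refine ⟨c, hcm, fun x hx hx' => ?_, fun x hx hx' => ?_⟩
    · have := mono x hx c hcm (by linarith)
      nlinarith
    · have := mono c hcm x hx (by linarith)
      nlinarith
  set p := max a (c - δ)
  set q := min b (c + δ)
  have hap : a ≤ p := le_max_left _ _
  have hpc : p ≤ c := max_le hcm.1 (by linarith)
  have hcq : c ≤ q := le_min hcm.2 (by linarith)
  have hqb : q ≤ b := min_le_left _ _
  have hp1 : c - δ ≤ p := le_max_right _ _
  have hq1 : q ≤ c + δ := min_le_right _ _
  have ci : ∀ u v, IntervalIntegrable (fun x => Complex.exp (I * (ψ x : ℂ))) volume u v :=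
    fun u v => Continuous.intervalIntegrable (by fun_prop) _ _
  rw [← intervalIntegral.integral_add_adjacent_intervals (ci a p) (ci p b),
    ← intervalIntegral.integral_add_adjacent_intervals (ci p q) (ci q b)]
  have i1 : ‖∫ x in a..p, Complex.exp (I * (ψ x : ℂ))‖ ≤ 4 / √μ := by
    rcases le_total (c - δ) a with h | h
    · have : p = a := max_eq_left h
      rw [this, intervalIntegral.integral_same, norm_zero]; positivity
    · have hp : p = c - δ := max_eq_right h
      apply vdc_one ψ ψ1 ψ2 h1 h2 hc a p _ hap hs
      · intro x hx
        exact hμ.le.trans (hlow x ⟨hx.1, by linarith [hx.2, hcm.2]⟩)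
      · intro x hx
        have := hcl x ⟨hx.1, by linarith [hx.2, hcm.2]⟩ (by linarith [hx.2])
        rw [abs_of_nonpos (by linarith)]; linarith
  have i3 : ‖∫ x in q..b, Complex.exp (I * (ψ x : ℂ))‖ ≤ 4 / √μ := by
    rcases le_total b (c + δ) with h | h
    · have : q = b := min_eq_left h
      rw [this, intervalIntegral.integral_same, norm_zero]; positivity
    · have hq : q = c + δ := min_eq_right h
      apply vdc_one ψ ψ1 ψ2 h1 h2 hc q b _ hqb hs
      · intro x hx
        exact hμ.le.trans (hlow x ⟨by linarith [hx.1, hcm.1], hx.2⟩)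
      · intro x hx
        have := hcr x ⟨by linarith [hx.1, hcm.1], hx.2⟩ (by linarith [hx.1])
        rw [abs_of_nonneg (by linarith)]; linarith
  have i2 : ‖∫ x in p..q, Complex.exp (I * (ψ x : ℂ))‖ ≤ 2 / √μ := by
    have := intervalIntegral.norm_integral_le_of_norm_le_const (a := p) (b := q) (C := 1)
      (f := fun x => Complex.exp (I * (ψ x : ℂ))) (fun x _ => (vdc_norm_exp _).le)
    rw [abs_of_nonneg (by linarith)] at this
    have e : 2 / √μ = δ + δ := by rw [hδ]; ring
    linarith
  have e : 10 / √μ = 4 / √μ + (2 / √μ + 4 / √μ) := by ring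
  rw [e]
  exact (norm_add_le _ _).trans (add_le_add i1 ((norm_add_le _ _).trans (add_le_add i2 i3)))

/-- Oscillatory integral with amplitude. -/
theorem vdc_amp (ψ : ℝ → ℝ) (c0 : Continuous ψ) (u u' : ℝ → ℂ) (hu : ∀ x, HasDerivAt u (u' x) x)
    (hu' : Continuous u') (a b K B B' : ℝ) (hab : a ≤ b)
    (hK : ∀ x ∈ Set.Icc a b, ‖∫ y in a..x, Complex.exp (I * (ψ y : ℂ))‖ ≤ K)
    (hB : ‖u b‖ ≤ B) (hB' : ∀ x ∈ Set.Icc a b, ‖u' x‖ ≤ B') :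
    ‖∫ x in a..b, u x * Complex.exp (I * (ψ x : ℂ))‖ ≤ K * (B + B' * (b - a)) := by
  have cE : Continuous (fun x => Complex.exp (I * (ψ x : ℂ))) := by fun_prop
  have hG : ∀ x, HasDerivAt (fun x => ∫ y in a..x, Complex.exp (I * (ψ y : ℂ)))
      (Complex.exp (I * (ψ x : ℂ))) x := fun x => cE.integral_hasStrictDerivAt a x |>.hasDerivAt
  rw [intervalIntegral.integral_mul_deriv_eq_deriv_mul (fun x _ => hu x) (fun x _ => hG x)
    (hu'.intervalIntegrable _ _) (cE.intervalIntegrable _ _)]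
  simp only [intervalIntegral.integral_same, mul_zero, sub_zero]
  have hbm : b ∈ Set.Icc a b := ⟨hab, le_rfl⟩
  have e1 : ‖u b * ∫ y in a..b, Complex.exp (I * (ψ y : ℂ))‖ ≤ B * K := by
    rw [norm_mul]
    exact mul_le_mul hB (hK b hbm) (norm_nonneg _) ((norm_nonneg _).trans hB)
  have e2 := intervalIntegral.norm_integral_le_of_norm_le_const (a := a) (b := b) (C := B' * K)
      (f := fun x => u' x * ∫ y in a..x, Complex.exp (I * (ψ y : ℂ))) (fun x hx => by
        rw [Set.uIoc_of_le hab] at hx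
        have hx' : x ∈ Set.Icc a b := ⟨hx.1.le, hx.2⟩
        rw [norm_mul]
        exact mul_le_mul (hB' x hx') (hK x hx') (norm_nonneg _) ((norm_nonneg _).trans (hB' x hx')))
  rw [abs_of_nonneg (by linarith)] at e2
  refine (norm_sub_le _ _).trans ?_
  nlinarith

theorem rad_angle_half (A : ℝ) :
    ∫ θ in (0:ℝ)..π, (Real.sin θ : ℂ) * Complex.exp (I * ((A * Real.cos θ : ℝ) : ℂ)) =
      2 * (Real.sinc A : ℂ) := by
  rcases eq_or_ne A 0 with rfl | hA
  · have : ∫ θ in (0:ℝ)..π, (Real.sin θ : ℂ) = ((∫ θ in (0:ℝ)..π, Real.sin θ : ℝ) : ℂ) :=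
      intervalIntegral.integral_ofReal
    simp only [zero_mul, Complex.ofReal_zero, mul_zero, Complex.exp_zero, mul_one, Real.sinc_zero]
    rw [this, integral_sin]
    simp
    norm_num
  · have hA' : (A : ℂ) ≠ 0 := by exact_mod_cast hA
    rw [intervalIntegral.integral_eq_sub_of_hasDerivAt
      (f := fun θ => (I / A) * Complex.exp (I * ((A * Real.cos θ : ℝ) : ℂ)))]
    · simp only [Real.cos_pi, Real.cos_zero, Real.sinc_of_ne_zero hA]
      push_cast
      have e1 : I * ((A : ℂ) * -1) = -(A * I) := by ring
      have e2 : I * ((A : ℂ) * 1) = A * I := by ring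
      rw [Complex.sin, e1, e2]
      field_simp
    · intro θ _
      have h := (vdc_hasDeriv ((Real.hasDerivAt_cos θ).const_mul A)).const_mul (I / (A : ℂ))
      refine h.congr_deriv ?_
      simp only [Complex.ofReal_mul, Complex.ofReal_neg]
      generalize Complex.exp (I * ((A : ℂ) * ((Real.cos θ : ℝ) : ℂ))) = E
      have e3 : I / (A : ℂ) * (E * (I * ((A : ℂ) * -((Real.sin θ : ℝ) : ℂ)))) =
          ((A : ℂ) / A) * (I * I) * (-((Real.sin θ : ℝ) : ℂ) * E) := by ring
      rw [e3, Complex.I_mul_I, div_self hA']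
      ring
    · apply Continuous.intervalIntegrable
      fun_prop

theorem rad_angle (A : ℝ) :
    ∫ θ in Set.Ioo (-π) π, ((|Real.sin θ| : ℝ) : ℂ) * Complex.exp (I * ((A * Real.cos θ : ℝ) : ℂ)) =
      4 * (Real.sinc A : ℂ) := by
  have hπ := Real.pi_pos
  rw [← integral_Ioc_eq_integral_Ioo, ← intervalIntegral.integral_of_le (by linarith)]
  have ci : ∀ u v : ℝ, IntervalIntegrable (fun θ : ℝ => ((|Real.sin θ| : ℝ) : ℂ) *
      Complex.exp (I * ((A * Real.cos θ : ℝ) : ℂ))) volume u v :=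
    fun u v => Continuous.intervalIntegrable (by fun_prop) _ _
  have h2 : ∫ θ in (0:ℝ)..π, ((|Real.sin θ| : ℝ) : ℂ) * Complex.exp (I * ((A * Real.cos θ : ℝ) : ℂ)) =
      2 * (Real.sinc A : ℂ) := by
    rw [← rad_angle_half A]
    apply intervalIntegral.integral_congr
    intro θ hθ
    rw [Set.uIcc_of_le hπ.le] at hθ
    simp only
    rw [abs_of_nonneg (Real.sin_nonneg_of_nonneg_of_le_pi hθ.1 hθ.2)]
  have h1 : ∫ θ in (-π)..(0:ℝ), ((|Real.sin θ| : ℝ) : ℂ) * Complex.exp (I * ((A * Real.cos θ : ℝ) : ℂ)) =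
      2 * (Real.sinc A : ℂ) := by
    rw [← h2]
    have := intervalIntegral.integral_comp_neg (a := 0) (b := π) (fun θ : ℝ => ((|Real.sin θ| : ℝ) : ℂ) *
      Complex.exp (I * ((A * Real.cos θ : ℝ) : ℂ)))
    simp only [Real.sin_neg, Real.cos_neg, abs_neg, neg_zero] at this
    exact this.symm
  rw [← intervalIntegral.integral_add_adjacent_intervals (ci (-π) 0) (ci 0 π), h1, h2]
  ring

theorem rad_two_dim (h : ℝ → ℂ) :
    ∫ w : EuclideanSpace ℝ (Fin 2), h ‖w‖ = π * ∫ v : ℝ, ((|v| : ℝ) : ℂ) * h |v| := by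
  have e1 := integral_fun_norm_addHaar (volume : Measure (EuclideanSpace ℝ (Fin 2))) h
  have e2 := integral_fun_norm_addHaar (volume : Measure ℝ) (fun v => ((v : ℝ) : ℂ) * h v)
  simp only [Real.norm_eq_abs] at e2
  rw [e1, e2]
  have v1 : (volume : Measure (EuclideanSpace ℝ (Fin 2))).real (Metric.ball 0 1) = π := by
    rw [Measure.real, EuclideanSpace.volume_ball_fin_two]
    simp [Real.pi_pos.le]
  have v2 : (volume : Measure ℝ).real (Metric.ball 0 1) = 2 := by
    rw [Measure.real, Real.volume_ball]; simp
  rw [v1, v2]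
  simp
  ring

theorem rad_polar (F : ℝ → ℂ) (hF : Continuous F) (R0 : ℝ)
    (hz : ∀ R, R0 ≤ R → F R = 0) (N : ℝ) :
    ∫ p : ℝ × ℝ, ((|p.2| : ℝ) : ℂ) * (Complex.exp (I * ((N * p.1 : ℝ) : ℂ)) * F (√(p.1 ^ 2 + |p.2| ^ 2))) =
      4 * ∫ R in Set.Ioi (0:ℝ), ((R * (R * Real.sinc (N * R)) : ℝ) : ℂ) * F R := by
  rw [← integral_comp_polarCoord_symm]
  have ht : polarCoord.target = Set.Ioi (0:ℝ) ×ˢ Set.Ioo (-π) π := rfl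
  have hm : MeasurableSet (Set.Ioi (0:ℝ) ×ˢ Set.Ioo (-π) π) := measurableSet_Ioi.prod measurableSet_Ioo
  rw [ht]
  have e1 : ∀ p ∈ Set.Ioi (0:ℝ) ×ˢ Set.Ioo (-π) π,
      p.1 • (((|(polarCoord.symm p).2| : ℝ) : ℂ) * (Complex.exp (I * ((N * (polarCoord.symm p).1 : ℝ) : ℂ)) *
        F (√((polarCoord.symm p).1 ^ 2 + |(polarCoord.symm p).2| ^ 2)))) =
      ((p.1 ^ 2 : ℝ) : ℂ) * F p.1 * (((|Real.sin p.2| : ℝ) : ℂ) * Complex.exp (I * ((N * p.1 * Real.cos p.2 : ℝ) : ℂ))) := by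
    rintro ⟨R, θ⟩ ⟨hR, hθ⟩
    have hR' : 0 < R := hR
    simp only [polarCoord_symm_apply]
    have : √((R * Real.cos θ) ^ 2 + |R * Real.sin θ| ^ 2) = R := by
      rw [sq_abs, mul_pow, mul_pow, ← mul_add, Real.cos_sq_add_sin_sq, mul_one, Real.sqrt_sq hR'.le]
    rw [this, abs_mul, abs_of_pos hR', ← mul_assoc N]
    rw [Complex.real_smul]
    push_cast
    ring
  rw [setIntegral_congr_fun hm e1]
  rw [Measure.volume_eq_prod, setIntegral_prod]
  · rw [← integral_const_mul]
    apply setIntegral_congr_fun measurableSet_Ioi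
    intro R hR
    simp only
    rw [integral_const_mul, rad_angle]
    push_cast
    ring
  · have hcomp : IntegrableOn (fun p : ℝ × ℝ => ((p.1 ^ 2 : ℝ) : ℂ) * F p.1 *
        (((|Real.sin p.2| : ℝ) : ℂ) * Complex.exp (I * ((N * p.1 * Real.cos p.2 : ℝ) : ℂ))))
        (Set.Icc (0:ℝ) R0 ×ˢ Set.Icc (-π) π) (volume.prod volume) := by
      rw [← Measure.volume_eq_prod]
      apply ContinuousOn.integrableOn_compact (isCompact_Icc.prod isCompact_Icc)
      apply Continuous.continuousOn
      fun_prop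
    apply hcomp.of_forall_sdiff_eq_zero hm
    rintro ⟨R, θ⟩ ⟨⟨h1, h2⟩, h3⟩
    have : R0 ≤ R := by
      by_contra hlt
      apply h3
      exact ⟨⟨le_of_lt h1, by simp at hlt; exact hlt.le⟩, ⟨h2.1.le, h2.2.le⟩⟩
    simp [hz R this]

theorem rad_rotate (F : ℝ → ℂ) (x : EuclideanSpace ℝ (Fin 3)) :
    ∫ ξ : EuclideanSpace ℝ (Fin 3), Complex.exp (I * (dotE x ξ : ℂ)) * F ‖ξ‖ =
      ∫ ξ : EuclideanSpace ℝ (Fin 3), Complex.exp (I * ((‖x‖ * ξ 0 : ℝ) : ℂ)) * F ‖ξ‖ := by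
  set w : EuclideanSpace ℝ (Fin 3) := EuclideanSpace.single 0 ‖x‖ with hw
  have hn : ‖x‖ = ‖w‖ := by simp [hw]
  set T := (Submodule.span ℝ {x - w})ᗮ.reflection with hT
  have hTx : T x = w := Submodule.reflection_sub hn
  have hdot : ∀ ξ, dotE x ξ = ‖x‖ * (T ξ) 0 := by
    intro ξ
    have h1 : dotE x ξ = inner ℝ x ξ := by
      simp [dotE, PiLp.inner_apply, mul_comm]
    rw [h1, ← T.inner_map_map, hTx, hw, EuclideanSpace.inner_single_left]
    simp
  have := (T.measurePreserving).integral_comp T.toHomeomorph.toMeasurableEquiv.measurableEmbedding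
    (fun ξ => Complex.exp (I * ((‖x‖ * ξ 0 : ℝ) : ℂ)) * F ‖ξ‖)
  rw [← this]
  simp only [hdot, LinearIsometryEquiv.norm_map]

theorem rad_main (F : ℝ → ℂ) (hF : Continuous F) (R0 : ℝ) (hR0 : 0 < R0)
    (hz : ∀ R, R0 ≤ R → F R = 0) (x : EuclideanSpace ℝ (Fin 3)) :
    ∫ ξ : EuclideanSpace ℝ (Fin 3), Complex.exp (I * (dotE x ξ : ℂ)) * F ‖ξ‖ =
      4 * π * ∫ R in Set.Ioi (0:ℝ), ((R * (R * Real.sinc (‖x‖ * R)) : ℝ) : ℂ) * F R := by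
  rw [rad_rotate]
  set N := ‖x‖
  set G : EuclideanSpace ℝ (Fin 3) → ℂ := fun ξ => Complex.exp (I * ((N * ξ 0 : ℝ) : ℂ)) * F ‖ξ‖ with hG
  have hGi : Integrable G := by
    apply Continuous.integrable_of_hasCompactSupport
    · fun_prop
    · apply HasCompactSupport.intro (isCompact_closedBall 0 R0)
      intro ξ hξ
      simp only [Metric.mem_closedBall, dist_zero_right, not_le] at hξ
      simp [hG, hz _ hξ.le]
  have mp1 := PiLp.volume_preserving_toLp (Fin 3)
  have mp2 := (volume_preserving_piFinSuccAbove (fun _ : Fin 3 => ℝ) 0).symm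
  have me1 := (MeasurableEquiv.toLp 2 (Fin 3 → ℝ)).measurableEmbedding
  have me2 := (MeasurableEquiv.piFinSuccAbove (fun _ : Fin 3 => ℝ) 0).symm.measurableEmbedding
  have hi1 := (mp1.integrable_comp_emb me1).2 hGi
  have hi2 := (mp2.integrable_comp_emb me2).2 hi1
  have e : ∀ p : ℝ × (Fin 2 → ℝ),
      G (WithLp.toLp 2 ((MeasurableEquiv.piFinSuccAbove (fun _ : Fin 3 => ℝ) 0).symm p)) =
      Complex.exp (I * ((N * p.1 : ℝ) : ℂ)) * F (√(p.1 ^ 2 + ‖(WithLp.toLp 2 p.2 : EuclideanSpace ℝ (Fin 2))‖ ^ 2)) := by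
    rintro ⟨z, w⟩
    have hh : (MeasurableEquiv.piFinSuccAbove (fun _ : Fin 3 => ℝ) 0).symm (z, w) = Fin.cons z w := by
      simp [MeasurableEquiv.piFinSuccAbove]
      rfl
    rw [hG]
    simp only [hh]
    rw [EuclideanSpace.norm_eq, EuclideanSpace.norm_sq_eq]
    simp [Fin.sum_univ_succ]
  have s1 : ∫ ξ, G ξ = ∫ p : ℝ × (Fin 2 → ℝ), Complex.exp (I * ((N * p.1 : ℝ) : ℂ)) *
      F (√(p.1 ^ 2 + ‖(WithLp.toLp 2 p.2 : EuclideanSpace ℝ (Fin 2))‖ ^ 2)) := by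
    rw [← mp1.integral_comp me1, ← mp2.integral_comp me2]
    exact integral_congr_ae (Filter.Eventually.of_forall e)
  have hi3 : Integrable (fun p : ℝ × (Fin 2 → ℝ) => Complex.exp (I * ((N * p.1 : ℝ) : ℂ)) *
      F (√(p.1 ^ 2 + ‖(WithLp.toLp 2 p.2 : EuclideanSpace ℝ (Fin 2))‖ ^ 2))) :=
    hi2.congr (Filter.Eventually.of_forall e)
  rw [s1, Measure.volume_eq_prod, integral_prod _ hi3]
  have s2 : ∀ z : ℝ, ∫ w : Fin 2 → ℝ, Complex.exp (I * ((N * z : ℝ) : ℂ)) *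
      F (√(z ^ 2 + ‖(WithLp.toLp 2 w : EuclideanSpace ℝ (Fin 2))‖ ^ 2)) =
      π * ∫ v : ℝ, ((|v| : ℝ) : ℂ) * (Complex.exp (I * ((N * z : ℝ) : ℂ)) * F (√(z ^ 2 + |v| ^ 2))) := by
    intro z
    rw [← rad_two_dim (fun r => Complex.exp (I * ((N * z : ℝ) : ℂ)) * F (√(z ^ 2 + r ^ 2)))]
    exact (PiLp.volume_preserving_toLp (Fin 2)).integral_comp
      (MeasurableEquiv.toLp 2 (Fin 2 → ℝ)).measurableEmbedding
      (fun w => Complex.exp (I * ((N * z : ℝ) : ℂ)) * F (√(z ^ 2 + ‖w‖ ^ 2)))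
  simp only [s2]
  rw [integral_const_mul]
  have hi4 : Integrable (fun p : ℝ × ℝ => ((|p.2| : ℝ) : ℂ) *
      (Complex.exp (I * ((N * p.1 : ℝ) : ℂ)) * F (√(p.1 ^ 2 + |p.2| ^ 2)))) := by
    apply Continuous.integrable_of_hasCompactSupport
    · fun_prop
    · apply HasCompactSupport.intro (isCompact_closedBall 0 R0)
      intro p hp
      simp only [Metric.mem_closedBall, dist_zero_right, not_le, Prod.norm_def, lt_max_iff,
        Real.norm_eq_abs] at hp
      have : R0 ≤ √(p.1 ^ 2 + |p.2| ^ 2) := by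
        apply Real.le_sqrt_of_sq_le
        rcases hp with h | h
        · have := sq_abs p.1
          nlinarith [sq_nonneg |p.2|]
        · nlinarith [sq_nonneg p.1]
      rw [hz _ this, mul_zero, mul_zero]
  rw [mul_comm (4:ℂ), mul_assoc, ← rad_polar F hF R0 hz N, Measure.volume_eq_prod, integral_prod _ hi4]

/-- `S_M(r) = r sinc(M r)`. -/
def sincS (M r : ℝ) : ℝ := r * Real.sinc (M * r)

theorem sincS_hasDeriv (M r : ℝ) : HasDerivAt (sincS M) (Real.cos (M * r)) r := by
  rcases eq_or_ne M 0 with rfl | hM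
  · have : sincS 0 = fun r => r := by funext r; simp [sincS]
    rw [this]; exact (hasDerivAt_id' r).congr_deriv (by simp)
  · have : sincS M = fun r => Real.sin (M * r) / M := by
      funext r
      rcases eq_or_ne r 0 with rfl | hr
      · simp [sincS]
      · rw [sincS, Real.sinc_of_ne_zero (mul_ne_zero hM hr)]
        field_simp
    rw [this]
    have h := (((hasDerivAt_id r).const_mul M).sin).div_const M
    refine h.congr_deriv ?_
    simp only [id]
    field_simp

theorem sincS_bound (M r : ℝ) (hr : r ∈ Set.Icc (1/4 : ℝ) 4) : |sincS M r| ≤ 4 := by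
  rw [sincS, abs_mul]
  have h1 : |Real.sinc (M * r)| ≤ 1 := abs_le.2 ⟨Real.neg_one_le_sinc _, Real.sinc_le_one _⟩
  have h2 : |r| ≤ 4 := abs_le.2 ⟨by linarith [hr.1], hr.2⟩
  calc |r| * |Real.sinc (M * r)| ≤ 4 * 1 := mul_le_mul h2 h1 (abs_nonneg _) (by norm_num)
    _ = 4 := by norm_num

theorem wt_hasDeriv (β l r : ℝ) : HasDerivAt (fun r : ℝ => (1 + l ^ 2 * r ^ 2) ^ β)
    (2 * l ^ 2 * r * β * (1 + l ^ 2 * r ^ 2) ^ (β - 1)) r := by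
  have h0 : HasDerivAt (fun r : ℝ => 1 + l ^ 2 * r ^ 2) (l ^ 2 * (2 * r)) r := by
    have := ((hasDerivAt_pow 2 r).const_mul (l ^ 2)).const_add 1
    refine this.congr_deriv ?_
    simp
  have := h0.rpow_const (p := β) (Or.inl (by positivity))
  refine this.congr_deriv ?_
  ring

theorem amp_exists (β : ℝ) (χ : ℝ → ℝ) (hχ : ContDiff ℝ (⊤ : ℕ∞) χ) :
    ∃ B1 B2 : ℝ → ℝ → ℝ, ∃ C : ℝ, 0 ≤ C ∧
      (∀ l r, HasDerivAt (fun r : ℝ => (1 + l ^ 2 * r ^ 2) ^ β * χ r) (B1 l r) r) ∧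
      (∀ l r, HasDerivAt (B1 l) (B2 l r) r) ∧ (∀ l, Continuous (B2 l)) ∧
      ∀ l ∈ Set.Icc (0:ℝ) 2, ∀ r ∈ Set.Icc (1/4 : ℝ) 4,
        |(1 + l ^ 2 * r ^ 2) ^ β * χ r| ≤ C ∧ |B1 l r| ≤ C ∧ |B2 l r| ≤ C := by
  have hχ' : ContDiff ℝ (⊤ : ℕ∞) (deriv χ) := (contDiff_infty_iff_deriv.1 hχ).2
  have hχ'' : ContDiff ℝ (⊤ : ℕ∞) (deriv (deriv χ)) := (contDiff_infty_iff_deriv.1 hχ').2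
  have d0 : ∀ r, HasDerivAt χ (deriv χ r) r := fun r =>
    (hχ.differentiable (by simp)).differentiableAt.hasDerivAt
  have d1 : ∀ r, HasDerivAt (deriv χ) (deriv (deriv χ) r) r := fun r =>
    (hχ'.differentiable (by simp)).differentiableAt.hasDerivAt
  have k0 := hχ.continuous
  have k1 := hχ'.continuous
  have k2 := hχ''.continuous
  have cw : ∀ β : ℝ, Continuous (fun p : ℝ × ℝ => (1 + p.1 ^ 2 * p.2 ^ 2) ^ β) := by
    intro β
    apply Continuous.rpow_const (by fun_prop)
    intro p
    left
    positivity
  let b1 : ℝ → ℝ → ℝ := fun l r => 2 * l ^ 2 * r * β * (1 + l ^ 2 * r ^ 2) ^ (β - 1) * χ r +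
    (1 + l ^ 2 * r ^ 2) ^ β * deriv χ r
  let b2 : ℝ → ℝ → ℝ := fun l r => (2 * l ^ 2 * β * (1 + l ^ 2 * r ^ 2) ^ (β - 1) +
      2 * l ^ 2 * r * β * (2 * l ^ 2 * r * (β - 1) * (1 + l ^ 2 * r ^ 2) ^ (β - 1 - 1))) * χ r +
      2 * l ^ 2 * r * β * (1 + l ^ 2 * r ^ 2) ^ (β - 1) * deriv χ r +
      (2 * l ^ 2 * r * β * (1 + l ^ 2 * r ^ 2) ^ (β - 1) * deriv χ r +
      (1 + l ^ 2 * r ^ 2) ^ β * deriv (deriv χ) r)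
  have c0 : Continuous (fun p : ℝ × ℝ => (1 + p.1 ^ 2 * p.2 ^ 2) ^ β * χ p.2) := by
    have := cw β
    fun_prop
  have c1 : Continuous (fun p : ℝ × ℝ => b1 p.1 p.2) := by
    have := cw β
    have := cw (β - 1)
    simp only [b1]
    fun_prop
  have c2 : Continuous (fun p : ℝ × ℝ => b2 p.1 p.2) := by
    have := cw β
    have := cw (β - 1)
    have := cw (β - 1 - 1)
    simp only [b2]
    fun_prop
  have hcomp : IsCompact (Set.Icc (0:ℝ) 2 ×ˢ Set.Icc (1/4 : ℝ) 4) := isCompact_Icc.prod isCompact_Icc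
  obtain ⟨C0, h0⟩ := hcomp.exists_bound_of_continuousOn c0.continuousOn
  obtain ⟨C1, h1⟩ := hcomp.exists_bound_of_continuousOn c1.continuousOn
  obtain ⟨C2, h2⟩ := hcomp.exists_bound_of_continuousOn c2.continuousOn
  refine ⟨b1, b2, max 0 (max C0 (max C1 C2)), le_max_left _ _, ?_, ?_, ?_, ?_⟩
  · intro l r
    exact (wt_hasDeriv β l r).mul (d0 r)
  · intro l r
    have hA : HasDerivAt (fun r : ℝ => 2 * l ^ 2 * r * β) (2 * l ^ 2 * β) r := by
      have := ((hasDerivAt_id r).const_mul (2 * l ^ 2)).mul_const β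
      simpa using this
    have h := ((hA.mul (wt_hasDeriv (β - 1) l r)).mul (d0 r)).add ((wt_hasDeriv β l r).mul (d1 r))
    exact h
  · intro l
    exact c2.comp (by fun_prop : Continuous fun r : ℝ => (l, r))
  · intro l hl r hr
    have hm : ((l, r) : ℝ × ℝ) ∈ Set.Icc (0:ℝ) 2 ×ˢ Set.Icc (1/4 : ℝ) 4 := ⟨hl, hr⟩
    refine ⟨(h0 _ hm).trans ?_, (h1 _ hm).trans ?_, (h2 _ hm).trans ?_⟩ <;> simp

/-- phase and its derivatives -/
def phs (l t m r : ℝ) : ℝ := t * √(1 + l ^ 2 * r ^ 2) + m * r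
def phs1 (l t m r : ℝ) : ℝ := t * (l ^ 2 * r / √(1 + l ^ 2 * r ^ 2)) + m
def phs2 (l t r : ℝ) : ℝ := t * (l ^ 2 / √(1 + l ^ 2 * r ^ 2) ^ 3)

theorem jp_pos (l r : ℝ) : 0 < √(1 + l ^ 2 * r ^ 2) := Real.sqrt_pos.2 (by positivity)

theorem jp_deriv (l r : ℝ) : HasDerivAt (fun r : ℝ => √(1 + l ^ 2 * r ^ 2))
    (l ^ 2 * r / √(1 + l ^ 2 * r ^ 2)) r := by
  have h0 : HasDerivAt (fun r : ℝ => 1 + l ^ 2 * r ^ 2) (l ^ 2 * (2 * r)) r := by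
    have := ((hasDerivAt_pow 2 r).const_mul (l ^ 2)).const_add 1
    refine this.congr_deriv ?_
    simp
  refine (h0.sqrt (by positivity)).congr_deriv ?_
  have := jp_pos l r
  field_simp

theorem phs_deriv (l t m r : ℝ) : HasDerivAt (phs l t m) (phs1 l t m r) r := by
  have h := ((jp_deriv l r).const_mul t).add ((hasDerivAt_id r).const_mul m)
  refine h.congr_deriv ?_
  simp [phs1]

theorem phs1_deriv (l t m r : ℝ) : HasDerivAt (phs1 l t m) (phs2 l t r) r := by
  have hp := jp_pos l r
  have h := ((((hasDerivAt_id r).const_mul (l ^ 2)).div (jp_deriv l r) hp.ne').const_mul t).add_const m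
  refine h.congr_deriv ?_
  have hsq : √(1 + l ^ 2 * r ^ 2) ^ 2 = 1 + l ^ 2 * r ^ 2 := Real.sq_sqrt (by positivity)
  simp only [id, phs2]
  generalize √(1 + l ^ 2 * r ^ 2) = y at *
  congr 1
  field_simp
  rw [hsq]; ring

theorem phs2_cont (l t : ℝ) : Continuous (phs2 l t) := by
  unfold phs2
  refine continuous_const.mul (continuous_const.div (by fun_prop) ?_)
  intro r
  exact pow_ne_zero _ (jp_pos l r).ne'

theorem phs_cont (l t m : ℝ) : Continuous (phs l t m) := by
  unfold phs; fun_prop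

theorem osc_two (l t m : ℝ) (hl : l ∈ Set.Icc (0:ℝ) 2) (hs : 0 < l ^ 2 * t) (u u' : ℝ → ℂ)
    (hu : ∀ x, HasDerivAt u (u' x) x) (hu' : Continuous u') (B B' : ℝ)
    (hB : ‖u 4‖ ≤ B) (hB' : ∀ x ∈ Set.Icc (1/4:ℝ) 4, ‖u' x‖ ≤ B') :
    ‖∫ r in (1/4:ℝ)..4, u r * Complex.exp (I * (phs l t m r : ℂ))‖ ≤
      270 / √(l ^ 2 * t) * (B + B' * (4 - 1/4)) := by
  apply vdc_amp (phs l t m) (phs_cont l t m) u u' hu hu' (1/4) 4 _ B B' (by norm_num) ?_ hB hB'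
  intro x hx
  have hlow : ∀ y ∈ Set.Icc (1/4:ℝ) x, l ^ 2 * t / 729 ≤ phs2 l t y := by
    intro y hy
    have hp := jp_pos l y
    have h9 : √(1 + l ^ 2 * y ^ 2) ≤ 9 := by
      apply Real.sqrt_le_iff.2 ⟨by norm_num, ?_⟩
      have h1 : l ^ 2 ≤ 4 := by nlinarith [hl.1, hl.2]
      have h2 : y ^ 2 ≤ 16 := by nlinarith [hy.1, hy.2, hx.2]
      nlinarith [mul_le_mul h1 h2 (sq_nonneg y) (by norm_num)]
    have h93 : √(1 + l ^ 2 * y ^ 2) ^ 3 ≤ 729 := by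
      calc √(1 + l ^ 2 * y ^ 2) ^ 3 ≤ 9 ^ 3 := pow_le_pow_left₀ hp.le h9 3
        _ = 729 := by norm_num
    unfold phs2
    have : t * (l ^ 2 / √(1 + l ^ 2 * y ^ 2) ^ 3) = l ^ 2 * t / √(1 + l ^ 2 * y ^ 2) ^ 3 := by ring
    rw [this]
    exact div_le_div_of_nonneg_left hs.le (by positivity) h93
  have := vdc_two (phs l t m) (phs1 l t m) (phs2 l t) (phs_deriv l t m) (phs1_deriv l t m) (phs2_cont l t)
    (1/4) x (l ^ 2 * t / 729) hx.1 (by positivity) hlow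
  refine this.trans (le_of_eq ?_)
  have h27 : √(729:ℝ) = 27 := by
    rw [show (729:ℝ) = 27 ^ 2 by norm_num]; exact Real.sqrt_sq (by norm_num)
  rw [Real.sqrt_div hs.le, h27]
  have := Real.sqrt_pos.2 hs
  field_simp
  norm_num

theorem osc_one (l t m M : ℝ) (hs : 0 ≤ l ^ 2 * t) (hM : 0 < M) (hm : |m| = M)
    (hMs : 8 * (l ^ 2 * t) ≤ M) (ht : 0 ≤ t) (u u' : ℝ → ℂ)
    (hu : ∀ x, HasDerivAt u (u' x) x) (hu' : Continuous u') (B B' : ℝ)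
    (hB : ‖u 4‖ ≤ B) (hB' : ∀ x ∈ Set.Icc (1/4:ℝ) 4, ‖u' x‖ ≤ B') :
    ‖∫ r in (1/4:ℝ)..4, u r * Complex.exp (I * (phs l t m r : ℂ))‖ ≤
      8 / M * (B + B' * (4 - 1/4)) := by
  apply vdc_amp (phs l t m) (phs_cont l t m) u u' hu hu' (1/4) 4 _ B B' (by norm_num) ?_ hB hB'
  intro x hx
  have hlow : ∀ y ∈ Set.Icc (1/4:ℝ) x, M / 2 ≤ |phs1 l t m y| := by
    intro y hy
    have hp := jp_pos l y
    have h1 : 1 ≤ √(1 + l ^ 2 * y ^ 2) := Real.one_le_sqrt.2 (by nlinarith [sq_nonneg (l * y)])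
    have e : t * (l ^ 2 * y / √(1 + l ^ 2 * y ^ 2)) = (l ^ 2 * t) * (y / √(1 + l ^ 2 * y ^ 2)) := by ring
    have hy4 : y / √(1 + l ^ 2 * y ^ 2) ≤ 4 := by
      rw [div_le_iff₀ hp]; nlinarith [hy.2, hx.2]
    have hy0 : 0 ≤ y / √(1 + l ^ 2 * y ^ 2) := div_nonneg (by linarith [hy.1]) hp.le
    have hb : |(l ^ 2 * t) * (y / √(1 + l ^ 2 * y ^ 2))| ≤ M / 2 := by
      rw [abs_of_nonneg (by positivity)]
      nlinarith
    unfold phs1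
    rw [e]
    have := abs_sub_abs_le_abs_sub m (-((l ^ 2 * t) * (y / √(1 + l ^ 2 * y ^ 2))))
    rw [abs_neg, sub_neg_eq_add, hm, add_comm m] at this
    linarith
  have hpos : ∀ y ∈ Set.Icc (1/4:ℝ) x, 0 ≤ phs2 l t y := by
    intro y _
    unfold phs2
    have := jp_pos l y
    positivity
  have := vdc_one (phs l t m) (phs1 l t m) (phs2 l t) (phs_deriv l t m) (phs1_deriv l t m) (phs2_cont l t)
    (1/4) x (M / 2) hx.1 (by positivity) hpos hlow
  refine this.trans (le_of_eq ?_)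
  field_simp
  norm_num

/-- The one dimensional integral. -/
def Jint (γ : ℝ) (χ : ℝ → ℝ) (l M t : ℝ) : ℂ :=
  ∫ r in (1/4:ℝ)..4, (((1 + l ^ 2 * r ^ 2) ^ (-γ / 2) * (r * χ r) * sincS M r : ℝ) : ℂ) *
    Complex.exp (I * ((t * √(1 + l ^ 2 * r ^ 2) : ℝ) : ℂ))

theorem Jint_neg (γ : ℝ) (χ : ℝ → ℝ) (l M t : ℝ) : ‖Jint γ χ l M (-t)‖ = ‖Jint γ χ l M t‖ := by
  have : Jint γ χ l M (-t) = (starRingEnd ℂ) (Jint γ χ l M t) := by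
    unfold Jint
    rw [intervalIntegral.integral_of_le (by norm_num), intervalIntegral.integral_of_le (by norm_num),
      ← integral_conj]
    congr 1
    funext r
    rw [map_mul, Complex.conj_ofReal, ← Complex.exp_conj, map_mul, Complex.conj_ofReal, Complex.conj_I]
    congr 2
    push_cast
    ring
  rw [this, Complex.norm_conj]

theorem Jint_zero (γ : ℝ) (χ : ℝ → ℝ) (hχ : ContDiff ℝ (⊤ : ℕ∞) χ) :
    ∃ C : ℝ, 0 ≤ C ∧ ∀ l ∈ Set.Icc (0:ℝ) 2, ∀ M t : ℝ, ‖Jint γ χ l M t‖ ≤ C := by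
  obtain ⟨B1, B2, C, hC, -, -, -, hb⟩ := amp_exists (-γ / 2) (fun r => r * χ r) (contDiff_id.mul hχ)
  refine ⟨C * 4 * (4 - 1/4), by positivity, ?_⟩
  intro l hl M t
  have := intervalIntegral.norm_integral_le_of_norm_le_const (a := (1/4:ℝ)) (b := 4) (C := C * 4)
    (f := fun r => (((1 + l ^ 2 * r ^ 2) ^ (-γ / 2) * (r * χ r) * sincS M r : ℝ) : ℂ) *
    Complex.exp (I * ((t * √(1 + l ^ 2 * r ^ 2) : ℝ) : ℂ))) (by
      intro r hr
      rw [Set.uIoc_of_le (by norm_num)] at hr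
      have hr' : r ∈ Set.Icc (1/4:ℝ) 4 := ⟨hr.1.le, hr.2⟩
      rw [norm_mul, vdc_norm_exp, mul_one, Complex.norm_real, Real.norm_eq_abs, abs_mul]
      exact mul_le_mul (hb l hl r hr').1 (sincS_bound M r hr') (abs_nonneg _) hC)
  rw [abs_of_nonneg (by norm_num)] at this
  exact this

theorem exp_phs_split (l t M r : ℝ) :
    (Real.cos (M * r) : ℂ) * Complex.exp (I * ((t * √(1 + l ^ 2 * r ^ 2) : ℝ) : ℂ)) =
      (1 / 2 : ℂ) * Complex.exp (I * (phs l t M r : ℂ)) +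
      (1 / 2 : ℂ) * Complex.exp (I * (phs l t (-M) r : ℂ)) := by
  unfold phs
  rw [Complex.ofReal_add, Complex.ofReal_add, mul_add, mul_add, Complex.exp_add, Complex.exp_add,
    Complex.ofReal_cos, Complex.cos]
  push_cast
  have e1 : (M : ℂ) * r * I = I * (M * r) := by ring
  have e2 : -((M : ℂ) * r) * I = I * (-M * r) := by ring
  rw [e1, e2]
  ring

theorem exp_phs_split_sin (l t M r : ℝ) :
    (Real.sin (M * r) : ℂ) * Complex.exp (I * ((t * √(1 + l ^ 2 * r ^ 2) : ℝ) : ℂ)) =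
      (-I / 2 : ℂ) * Complex.exp (I * (phs l t M r : ℂ)) +
      (I / 2 : ℂ) * Complex.exp (I * (phs l t (-M) r : ℂ)) := by
  unfold phs
  rw [Complex.ofReal_add, Complex.ofReal_add, mul_add, mul_add, Complex.exp_add, Complex.exp_add,
    Complex.ofReal_sin, Complex.sin]
  push_cast
  have e1 : (M : ℂ) * r * I = I * (M * r) := by ring
  have e2 : -((M : ℂ) * r) * I = I * (-M * r) := by ring
  rw [e1, e2]
  ring

theorem exp_phs_cont (l t m : ℝ) : Continuous (fun r : ℝ => Complex.exp (I * (phs l t m r : ℂ))) := by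
  have := phs_cont l t m
  fun_prop

theorem Jint_large_M (γ : ℝ) (χ : ℝ → ℝ) (hχ : ContDiff ℝ (⊤ : ℕ∞) χ) :
    ∃ C : ℝ, 0 ≤ C ∧ ∀ l ∈ Set.Icc (0:ℝ) 2, ∀ M t : ℝ, 0 ≤ t → 0 < M → 8 * (l ^ 2 * t) ≤ M →
      ‖Jint γ χ l M t‖ ≤ C / M ^ 2 := by
  obtain ⟨B1, B2, C, hC, h1, h2, h3, hb⟩ := amp_exists (-γ / 2) (fun r => r * χ r) (contDiff_id.mul hχ)
  refine ⟨8 * (C + C * (4 - 1/4)), by positivity, ?_⟩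
  intro l hl M t ht hM hMs
  set u : ℝ → ℂ := fun r => (((1 + l ^ 2 * r ^ 2) ^ (-γ / 2) * (r * χ r) : ℝ) : ℂ) with hu
  have hud : ∀ r, HasDerivAt u ((B1 l r : ℝ) : ℂ) r := fun r => (h1 l r).ofReal_comp
  have cu : Continuous u := continuous_iff_continuousAt.2 fun r => (hud r).continuousAt
  have cB1 : Continuous (B1 l) := continuous_iff_continuousAt.2 fun r => (h2 l r).continuousAt
  have key : ∀ m, |m| = M → ‖∫ r in (1/4:ℝ)..4, u r * Complex.exp (I * (phs l t m r : ℂ))‖ ≤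
      8 / M * (C + C * (4 - 1/4)) := by
    intro m hm
    apply osc_one l t m M (by positivity) hM hm hMs ht u (fun r => ((B1 l r : ℝ) : ℂ)) hud
      (by fun_prop)
    · rw [hu, Complex.norm_real]
      exact (hb l hl 4 ⟨by norm_num, le_rfl⟩).1
    · intro r hr
      rw [Complex.norm_real]
      exact (hb l hl r hr).2.1
  have hMne : (M : ℂ) ≠ 0 := by exact_mod_cast hM.ne'
  have e : Jint γ χ l M t = (-I / 2 / M) * (∫ r in (1/4:ℝ)..4, u r * Complex.exp (I * (phs l t M r : ℂ))) +
      (I / 2 / M) * (∫ r in (1/4:ℝ)..4, u r * Complex.exp (I * (phs l t (-M) r : ℂ))) := by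
    rw [← intervalIntegral.integral_const_mul, ← intervalIntegral.integral_const_mul,
      ← intervalIntegral.integral_add]
    · apply intervalIntegral.integral_congr
      intro r hr
      rw [Set.uIcc_of_le (by norm_num)] at hr
      have hr0 : r ≠ 0 := by linarith [hr.1]
      have hS : sincS M r = Real.sin (M * r) / M := by
        rw [sincS, Real.sinc_of_ne_zero (mul_ne_zero hM.ne' hr0)]
        field_simp
      have hsp := exp_phs_split_sin l t M r
      simp only
      rw [hS, Complex.ofReal_mul, Complex.ofReal_div]
      calc u r * ((Real.sin (M * r) : ℂ) / M) * Complex.exp (I * ((t * √(1 + l ^ 2 * r ^ 2) : ℝ) : ℂ))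
          = u r / M * ((Real.sin (M * r) : ℂ) * Complex.exp (I * ((t * √(1 + l ^ 2 * r ^ 2) : ℝ) : ℂ))) := by ring
        _ = _ := by rw [hsp]; ring
    · exact (continuous_const.mul (cu.mul (exp_phs_cont l t M))).intervalIntegrable _ _
    · exact (continuous_const.mul (cu.mul (exp_phs_cont l t (-M)))).intervalIntegrable _ _
  rw [e]
  have n1 : ‖(-I / 2 / M : ℂ)‖ = 1 / 2 / M := by
    simp [abs_of_pos hM]
  have n2 : ‖(I / 2 / M : ℂ)‖ = 1 / 2 / M := by
    simp [abs_of_pos hM]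
  refine (norm_add_le _ _).trans ?_
  rw [norm_mul, norm_mul, n1, n2]
  have k1 := key M (abs_of_pos hM)
  have k2 := key (-M) (by rw [abs_neg, abs_of_pos hM])
  have hp : 0 ≤ 1 / 2 / M := by positivity
  calc _ ≤ 1 / 2 / M * (8 / M * (C + C * (4 - 1/4))) + 1 / 2 / M * (8 / M * (C + C * (4 - 1/4))) :=
        add_le_add (mul_le_mul_of_nonneg_left k1 hp) (mul_le_mul_of_nonneg_left k2 hp)
    _ = _ := by field_simp; ring

theorem Jint_large_s (γ : ℝ) (χ : ℝ → ℝ) (hχ : ContDiff ℝ (⊤ : ℕ∞) χ) (z1 : χ (1/4) = 0) (z4 : χ 4 = 0) :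
    ∃ C : ℝ, 0 ≤ C ∧ ∀ l ∈ Set.Icc (0:ℝ) 2, ∀ M t : ℝ, 0 < l ^ 2 * t →
      ‖Jint γ χ l M t‖ ≤ C / (l ^ 2 * t * √(l ^ 2 * t)) := by
  obtain ⟨B1, B2, C, hC, h1, h2, h3, hb⟩ := amp_exists ((1 - γ) / 2) χ hχ
  refine ⟨270 * (4 * C + 5 * C * (4 - 1/4)) + 270 * (C + C * (4 - 1/4)), by positivity, ?_⟩
  intro l hl M t hs
  set s := l ^ 2 * t with hsdef
  have hsne : (s : ℂ) ≠ 0 := by exact_mod_cast hs.ne'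
  have hsq := Real.sqrt_pos.2 hs
  set b : ℝ → ℝ := fun r => (1 + l ^ 2 * r ^ 2) ^ ((1 - γ) / 2) * χ r with hbdef
  have cb : Continuous b := continuous_iff_continuousAt.2 fun r => (h1 l r).continuousAt
  have cB1 : Continuous (B1 l) := continuous_iff_continuousAt.2 fun r => (h2 l r).continuousAt
  have cB2 := h3 l
  have cS : Continuous (sincS M) := continuous_iff_continuousAt.2 fun r => (sincS_hasDeriv M r).continuousAt
  have cj : Continuous (fun r : ℝ => l ^ 2 * r / √(1 + l ^ 2 * r ^ 2)) :=
    Continuous.div (by fun_prop) (by fun_prop) (fun r => (jp_pos l r).ne')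
  set E : ℝ → ℂ := fun r => Complex.exp (I * ((t * √(1 + l ^ 2 * r ^ 2) : ℝ) : ℂ)) with hE
  have cE : Continuous E := by simp only [hE]; fun_prop
  have hEd : ∀ r, HasDerivAt E (E r * (I * ((t * (l ^ 2 * r / √(1 + l ^ 2 * r ^ 2)) : ℝ) : ℂ))) r :=
    fun r => vdc_hasDeriv ((jp_deriv l r).const_mul t)
  have step1 : Jint γ χ l M t = (-I / s) * ∫ r in (1/4:ℝ)..4, ((b r * sincS M r : ℝ) : ℂ) *
      (E r * (I * ((t * (l ^ 2 * r / √(1 + l ^ 2 * r ^ 2)) : ℝ) : ℂ))) := by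
    rw [← intervalIntegral.integral_const_mul]
    apply intervalIntegral.integral_congr
    intro r _
    have hp := jp_pos l r
    have hw : (1 + l ^ 2 * r ^ 2) ^ ((1 - γ) / 2) = (1 + l ^ 2 * r ^ 2) ^ (-γ / 2) * √(1 + l ^ 2 * r ^ 2) := by
      rw [Real.sqrt_eq_rpow, ← Real.rpow_add (by positivity)]
      congr 1; ring
    have hreal : (1 + l ^ 2 * r ^ 2) ^ (-γ / 2) * (r * χ r) * sincS M r =
        1 / s * ((b r * sincS M r) * (t * (l ^ 2 * r / √(1 + l ^ 2 * r ^ 2)))) := by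
      simp only [hbdef]
      rw [hw]
      have : t * (l ^ 2 * r / √(1 + l ^ 2 * r ^ 2)) = s * (r / √(1 + l ^ 2 * r ^ 2)) := by
        rw [hsdef]; ring
      rw [this]
      have := hs.ne'
      field_simp
    simp only
    rw [hreal, Complex.ofReal_mul (1 / s), Complex.ofReal_mul (b r * sincS M r), Complex.ofReal_div, Complex.ofReal_one]
    generalize ((t * (l ^ 2 * r / √(1 + l ^ 2 * r ^ 2)) : ℝ) : ℂ) = Y
    generalize ((b r * sincS M r : ℝ) : ℂ) = X
    have : -I / (s : ℂ) * (X * (E r * (I * Y))) = -(I * I) * (1 / s * (X * Y) * E r) := by ring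
    rw [this, Complex.I_mul_I]
    simp [hE]
  have hud : ∀ r, HasDerivAt (fun r => ((b r * sincS M r : ℝ) : ℂ))
      ((B1 l r * sincS M r + b r * Real.cos (M * r) : ℝ) : ℂ) r :=
    fun r => ((h1 l r).mul (sincS_hasDeriv M r)).ofReal_comp
  have step2 : ∫ r in (1/4:ℝ)..4, ((b r * sincS M r : ℝ) : ℂ) *
      (E r * (I * ((t * (l ^ 2 * r / √(1 + l ^ 2 * r ^ 2)) : ℝ) : ℂ))) =
      - ∫ r in (1/4:ℝ)..4, ((B1 l r * sincS M r + b r * Real.cos (M * r) : ℝ) : ℂ) * E r := by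
    rw [intervalIntegral.integral_mul_deriv_eq_deriv_mul (fun r _ => hud r) (fun r _ => hEd r)]
    · simp [hbdef, z4, show χ 4⁻¹ = 0 by rw [← z1]; norm_num]
    · apply Continuous.intervalIntegrable; fun_prop
    · apply Continuous.intervalIntegrable; fun_prop
  have step3 : ∫ r in (1/4:ℝ)..4, ((B1 l r * sincS M r + b r * Real.cos (M * r) : ℝ) : ℂ) * E r =
      (∫ r in (1/4:ℝ)..4, ((B1 l r * sincS M r : ℝ) : ℂ) * Complex.exp (I * (phs l t 0 r : ℂ))) +
      ((1 / 2 : ℂ) * (∫ r in (1/4:ℝ)..4, ((b r : ℝ) : ℂ) * Complex.exp (I * (phs l t M r : ℂ))) +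
      (1 / 2 : ℂ) * (∫ r in (1/4:ℝ)..4, ((b r : ℝ) : ℂ) * Complex.exp (I * (phs l t (-M) r : ℂ)))) := by
    have c0 := exp_phs_cont l t 0
    have c1 := exp_phs_cont l t M
    have c2 := exp_phs_cont l t (-M)
    rw [← intervalIntegral.integral_const_mul, ← intervalIntegral.integral_const_mul,
      ← intervalIntegral.integral_add, ← intervalIntegral.integral_add]
    · apply intervalIntegral.integral_congr
      intro r _
      have hsp := exp_phs_split l t M r
      have h0 : Complex.exp (I * (phs l t 0 r : ℂ)) = E r := by simp [phs, hE]
      simp only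
      rw [h0, Complex.ofReal_add, add_mul, Complex.ofReal_mul (b r), mul_assoc (b r : ℂ), hsp]
      ring
    all_goals
      apply Continuous.intervalIntegrable
      fun_prop
  have hb4 := hb l hl 4 ⟨by norm_num, le_rfl⟩
  have i0 := osc_two l t 0 hl hs (fun r => ((B1 l r * sincS M r : ℝ) : ℂ))
    (fun r => ((B2 l r * sincS M r + B1 l r * Real.cos (M * r) : ℝ) : ℂ))
    (fun r => ((h2 l r).mul (sincS_hasDeriv M r)).ofReal_comp) (by fun_prop) (4 * C) (5 * C)
    (by
      rw [Complex.norm_real, Real.norm_eq_abs, abs_mul, mul_comm]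
      exact mul_le_mul (sincS_bound M 4 ⟨by norm_num, le_rfl⟩) hb4.2.1 (abs_nonneg _) (by norm_num))
    (by
      intro r hr
      rw [Complex.norm_real, Real.norm_eq_abs]
      have q := hb l hl r hr
      refine (abs_add_le _ _).trans ?_
      rw [abs_mul, abs_mul]
      have q1 := mul_le_mul q.2.2 (sincS_bound M r hr) (abs_nonneg _) hC
      have q2 := mul_le_mul q.2.1 (Real.abs_cos_le_one (M * r)) (abs_nonneg _) hC
      linarith)
  have i1 : ∀ m, ‖∫ r in (1/4:ℝ)..4, ((b r : ℝ) : ℂ) * Complex.exp (I * (phs l t m r : ℂ))‖ ≤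
      270 / √s * (C + C * (4 - 1/4)) := by
    intro m
    apply osc_two l t m hl hs (fun r => ((b r : ℝ) : ℂ)) (fun r => ((B1 l r : ℝ) : ℂ))
      (fun r => (h1 l r).ofReal_comp) (by fun_prop) C C
    · rw [Complex.norm_real]; exact hb4.1
    · intro r hr
      rw [Complex.norm_real]; exact (hb l hl r hr).2.1
  rw [step1, step2, step3, norm_mul, norm_neg]
  have n1 : ‖(-I / s : ℂ)‖ = 1 / s := by simp [abs_of_pos hs]
  rw [n1]
  have tot := norm_add₃_le (a := (∫ r in (1/4:ℝ)..4, ((B1 l r * sincS M r : ℝ) : ℂ) * Complex.exp (I * (phs l t 0 r : ℂ))))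
    (b := (1 / 2 : ℂ) * (∫ r in (1/4:ℝ)..4, ((b r : ℝ) : ℂ) * Complex.exp (I * (phs l t M r : ℂ))))
    (c := (1 / 2 : ℂ) * (∫ r in (1/4:ℝ)..4, ((b r : ℝ) : ℂ) * Complex.exp (I * (phs l t (-M) r : ℂ))))
  rw [add_assoc, norm_mul, norm_mul, show ‖(1/2:ℂ)‖ = 1/2 by simp] at tot
  have j1 := i1 M
  have j2 := i1 (-M)
  calc 1 / s * _ ≤ 1 / s * (270 / √s * (4 * C + 5 * C * (4 - 1/4)) + 270 / √s * (C + C * (4 - 1/4))) := by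
        apply mul_le_mul_of_nonneg_left _ (by positivity)
        linarith
    _ = _ := by field_simp

theorem pow_helper (y D : ℝ) (hy : 0 < y) (hD : 0 < D) (h : D ≤ 100 * y) :
    1 / (y * √y) ≤ 1000 * D ^ (-(3 / 2) : ℝ) := by
  have e : D ^ (-(3 / 2) : ℝ) = 1 / (D * √D) := by
    rw [Real.rpow_neg hD.le, ← one_div, Real.sqrt_eq_rpow, show (3 / 2 : ℝ) = 1 + 1 / 2 by norm_num,
      Real.rpow_add hD, Real.rpow_one]
  have h1 : √D ≤ 10 * √y := by
    have h2 := Real.sqrt_le_sqrt h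
    have h100 : √(100:ℝ) = 10 := by
      rw [show (100:ℝ) = 10 ^ 2 by norm_num]; exact Real.sqrt_sq (by norm_num)
    rwa [Real.sqrt_mul (by norm_num), h100] at h2
  have hsD := Real.sqrt_pos.2 hD
  have hsy := Real.sqrt_pos.2 hy
  rw [e, mul_one_div, div_le_div_iff₀ (by positivity) (by positivity)]
  have := mul_le_mul h h1 hsD.le (by positivity)
  nlinarith

theorem Jint_bound (γ : ℝ) (χ : ℝ → ℝ) (hχ : ContDiff ℝ (⊤ : ℕ∞) χ) (z1 : χ (1/4) = 0) (z4 : χ 4 = 0) :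
    ∃ C : ℝ, 0 < C ∧ ∀ l : ℝ, 0 < l → l ≤ 2 → ∀ N t : ℝ, 0 ≤ N →
      ‖Jint γ χ l (N * l) t‖ ≤ C * (1 + l ^ 2 * √(N ^ 2 + t ^ 2)) ^ (-(3 / 2) : ℝ) := by
  obtain ⟨C0, hC0, k0⟩ := Jint_zero γ χ hχ
  obtain ⟨C1, hC1, k1⟩ := Jint_large_s γ χ hχ z1 z4
  obtain ⟨C2, hC2, k2⟩ := Jint_large_M γ χ hχ
  refine ⟨1000 * (C0 + C1 + 2 * C2) + 1, by positivity, ?_⟩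
  intro l hl0 hl2 N t hN
  wlog ht : 0 ≤ t generalizing t
  · have := this (-t) (by linarith)
    rwa [Jint_neg, neg_sq] at this
  have hl : l ∈ Set.Icc (0:ℝ) 2 := ⟨hl0.le, hl2⟩
  have hsq : √(N ^ 2 + t ^ 2) ≤ N + t := by
    apply Real.sqrt_le_iff.2 ⟨by positivity, by nlinarith [mul_nonneg hN ht]⟩
  set M := N * l with hM
  set s := l ^ 2 * t with hs
  set D := 1 + l ^ 2 * √(N ^ 2 + t ^ 2) with hD
  have hM0 : 0 ≤ M := by positivity
  have hs0 : 0 ≤ s := by positivity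
  have hDpos : 0 < D := by positivity
  have hDle : D ≤ 1 + 2 * M + s := by
    have h1 : l ^ 2 * √(N ^ 2 + t ^ 2) ≤ l ^ 2 * (N + t) := mul_le_mul_of_nonneg_left hsq (by positivity)
    have h2 : l ^ 2 * (N + t) = l * M + s := by rw [hM, hs]; ring
    nlinarith
  set P := D ^ (-(3 / 2) : ℝ) with hP
  have hP0 : 0 < P := Real.rpow_pos_of_pos hDpos _
  have main : ‖Jint γ χ l M t‖ ≤ 1000 * (C0 + C1 + 2 * C2) * P := by
    have q0 : 0 ≤ C0 * P := by positivity
    have q1 : 0 ≤ C1 * P := by positivity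
    have q2 : 0 ≤ C2 * P := by positivity
    rcases le_total (2 * M + s) 1 with h | h
    · have := pow_helper 1 D one_pos hDpos (by linarith)
      simp only [Real.sqrt_one, mul_one, div_one] at this
      have a := k0 l hl M t
      have : C0 * 1 ≤ C0 * (1000 * P) := mul_le_mul_of_nonneg_left this hC0
      linarith
    rcases le_total M (8 * s) with h' | h'
    · have hspos : 0 < s := by linarith
      have := pow_helper s D hspos hDpos (by linarith)
      have a := k1 l hl M t hspos
      have : C1 * (1 / (s * √s)) ≤ C1 * (1000 * P) := mul_le_mul_of_nonneg_left this hC1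
      rw [mul_one_div] at this
      linarith
    · have hMpos : 0 < M := by linarith
      have := pow_helper M D hMpos hDpos (by linarith)
      have a := k2 l hl M t ht hMpos h'
      have hsM := Real.sqrt_pos.2 hMpos
      have b : 1 / M ^ 2 ≤ 2 * (1 / (M * √M)) := by
        have : √M ≤ 2 * M := by
          apply Real.sqrt_le_iff.2 ⟨by positivity, by nlinarith⟩
        rw [mul_one_div, div_le_div_iff₀ (by positivity) (by positivity)]
        nlinarith
      have : C2 * (1 / M ^ 2) ≤ C2 * (2 * (1000 * P)) := mul_le_mul_of_nonneg_left (by linarith) hC2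
      rw [mul_one_div] at this
      linarith
  calc _ ≤ 1000 * (C0 + C1 + 2 * C2) * P := main
    _ ≤ _ := by nlinarith

theorem Kloc_eq_s8 (γ : ℝ) (ρ : ℝ → ℝ)
    (hρ : ContDiff ℝ (⊤ : ℕ∞) ρ) (hρsupp : Function.support ρ ⊆ Set.Ioo (-2) 2)
    (hρ1 : ∀ s : ℝ, |s| ≤ 1 → ρ s = 1) (k : ℤ) (x : EuclideanSpace ℝ (Fin 3)) (t : ℝ) :
    Kloc ρ γ k x t = 4 * π * ((((2:ℝ) ^ k) ^ 3 : ℝ) : ℂ) *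
      Jint γ (fun r => ρ (r / 2) - ρ (4 * r)) ((2:ℝ) ^ k) (‖x‖ * (2:ℝ) ^ k) t := by
  set l : ℝ := (2:ℝ) ^ k with hl
  have hl0 : 0 < l := by positivity
  have hz2 : ∀ s : ℝ, 2 ≤ s → ρ s = 0 := by
    intro s hs
    by_contra h
    have := (hρsupp h).2
    linarith
  set χ : ℝ → ℝ := fun r => ρ (r / 2) - ρ (4 * r) with hχ
  have c1 : (2:ℝ) ^ (-(k + 1)) = 1 / (2 * l) := by
    rw [zpow_neg, zpow_add₀ (by norm_num), zpow_one, one_div, mul_comm]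
  have c2 : (2:ℝ) ^ (-(k - 2)) = 4 / l := by
    rw [zpow_neg, zpow_sub₀ (by norm_num), inv_div]
    norm_num
    rfl
  set F : ℝ → ℂ := fun R => (((1 + R ^ 2) ^ (-γ / 2) * χ (R / l) : ℝ) : ℂ) *
    Complex.exp (I * ((t * √(1 + R ^ 2) : ℝ) : ℂ)) with hF
  have hρc := hρ.continuous
  have hχc : Continuous χ := by simp only [hχ]; fun_prop
  have hFc : Continuous F := by
    have : Continuous (fun R : ℝ => (1 + R ^ 2) ^ (-γ / 2)) :=
      Continuous.rpow_const (by fun_prop) (fun R => Or.inl (by positivity))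
    simp only [hF]
    fun_prop
  have hχ4 : ∀ r, 4 ≤ r → χ r = 0 := by
    intro r hr
    simp only [hχ]
    rw [hz2 _ (by linarith), hz2 _ (by linarith), sub_zero]
  have hχ0 : ∀ r, 0 < r → r ≤ 1/4 → χ r = 0 := by
    intro r hr hr'
    simp only [hχ]
    rw [hρ1 _ (by rw [abs_of_pos (by positivity)]; linarith),
      hρ1 _ (by rw [abs_of_pos (by positivity)]; linarith), sub_self]
  have hFz : ∀ R, 4 * l ≤ R → F R = 0 := by
    intro R hR
    simp only [hF]
    rw [hχ4 (R / l) (by rwa [le_div_iff₀ hl0])]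
    simp
  have e1 : Kloc ρ γ k x t = ∫ ξ : EuclideanSpace ℝ (Fin 3), Complex.exp (I * (dotE x ξ : ℂ)) * F ‖ξ‖ := by
    unfold Kloc
    congr 1
    funext ξ
    have hj : jap ξ ^ (-γ) = (1 + ‖ξ‖ ^ 2) ^ (-γ / 2) := by
      unfold jap
      rw [Real.sqrt_eq_rpow, ← Real.rpow_mul (by positivity)]
      congr 1; ring
    have hc : chiLP ρ k ξ = χ (‖ξ‖ / l) := by
      unfold chiLP
      rw [c1, c2]
      simp only [hχ]
      congr 2
      · field_simp
      · ring
    simp only [hF]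
    rw [hj, hc, mul_add, Complex.exp_add]
    simp only [jap, Complex.ofReal_mul]
    ring
  rw [e1, rad_main F hFc (4 * l) (by positivity) hFz x]
  have e2 := integral_comp_mul_left_Ioi (fun R => ((R * (R * Real.sinc (‖x‖ * R)) : ℝ) : ℂ) * F R) 0 hl0
  rw [mul_zero] at e2
  have e3 : ∫ R in Set.Ioi (0:ℝ), ((R * (R * Real.sinc (‖x‖ * R)) : ℝ) : ℂ) * F R =
      (l : ℂ) * ∫ r in Set.Ioi (0:ℝ), (((l * r) * ((l * r) * Real.sinc (‖x‖ * (l * r))) : ℝ) : ℂ) * F (l * r) := by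
    rw [e2, Complex.real_smul, ← mul_assoc, ← Complex.ofReal_mul, mul_inv_cancel₀ hl0.ne']
    simp
  have e4 : ∫ r in Set.Ioi (0:ℝ), (((l * r) * ((l * r) * Real.sinc (‖x‖ * (l * r))) : ℝ) : ℂ) * F (l * r) =
      ((l ^ 2 : ℝ) : ℂ) * Jint γ χ l (‖x‖ * l) t := by
    have e5 : ∫ r in Set.Ioi (0:ℝ), (((l * r) * ((l * r) * Real.sinc (‖x‖ * (l * r))) : ℝ) : ℂ) * F (l * r) =
      ∫ r in Set.Ioc (1/4:ℝ) 4, (((l * r) * ((l * r) * Real.sinc (‖x‖ * (l * r))) : ℝ) : ℂ) * F (l * r) := by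
      apply setIntegral_eq_of_subset_of_forall_sdiff_eq_zero measurableSet_Ioi
      · intro r hr
        have := hr.1
        simp only [Set.mem_Ioi]
        linarith
      · rintro r ⟨hr, hr'⟩
        have hrp : 0 < r := hr
        have : χ r = 0 := by
          rcases le_or_gt r (1/4) with h | h
          · exact hχ0 r hrp h
          · rcases le_or_gt r 4 with h4 | h4
            · exact absurd ⟨h, h4⟩ hr'
            · exact hχ4 r h4.le
        simp only [hF]
        rw [mul_div_cancel_left₀ r hl0.ne', this]
        simp
    rw [e5]
    unfold Jint
    rw [← intervalIntegral.integral_of_le (by norm_num), ← intervalIntegral.integral_const_mul]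
    apply intervalIntegral.integral_congr
    intro r _
    simp only [hF, sincS]
    rw [mul_div_cancel_left₀ r hl0.ne', mul_pow, ← mul_assoc ‖x‖]
    push_cast
    ring
  rw [e3, e4]
  push_cast
  ring

theorem Kloc_pointwise_low (γ : ℝ) (hγ : 0 ≤ γ) (ρ : ℝ → ℝ)
    (hρ : ContDiff ℝ (⊤ : ℕ∞) ρ) (hρsupp : Function.support ρ ⊆ Set.Ioo (-2) 2)
    (hρ1 : ∀ s : ℝ, |s| ≤ 1 → ρ s = 1) :
    ∃ C : ℝ, 0 < C ∧ ∀ k : ℤ, k ≤ 1 → ∀ (x : EuclideanSpace ℝ (Fin 3)) (t : ℝ),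
      ‖Kloc ρ γ k x t‖ ≤
        C * (2 : ℝ) ^ (3 * k) * (1 + (2 : ℝ) ^ (2 * k) * xtNorm x t) ^ (-(3 / 2) : ℝ) := by
  have hχ : ContDiff ℝ (⊤ : ℕ∞) (fun r : ℝ => ρ (r / 2) - ρ (4 * r)) :=
    (hρ.comp (contDiff_id.div_const 2)).sub (hρ.comp (contDiff_const.mul contDiff_id))
  have hz2 : ∀ s : ℝ, 2 ≤ s → ρ s = 0 := by
    intro s hs
    by_contra h
    have := (hρsupp h).2
    linarith
  obtain ⟨C, hC, hb⟩ := Jint_bound γ (fun r : ℝ => ρ (r / 2) - ρ (4 * r)) hχ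
    (by
      rw [hρ1 _ (by rw [abs_of_pos (by norm_num)]; norm_num),
        hρ1 _ (by rw [abs_of_pos (by norm_num)]; norm_num), sub_self])
    (by
      rw [hz2 _ (by norm_num), hz2 _ (by norm_num), sub_self])
  refine ⟨4 * π * C, by positivity, ?_⟩
  intro k hk x t
  rw [Kloc_eq_s8 γ ρ hρ hρsupp hρ1 k x t]
  have hl2 : (2:ℝ) ^ k ≤ 2 := by
    calc (2:ℝ) ^ k ≤ 2 ^ (1:ℤ) := zpow_le_zpow_right₀ (by norm_num) hk
      _ = 2 := zpow_one _
  have h := hb ((2:ℝ) ^ k) (by positivity) hl2 ‖x‖ t (norm_nonneg x)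
  have e2 : (2:ℝ) ^ (2 * k) = ((2:ℝ) ^ k) ^ 2 := by rw [mul_comm, zpow_mul]; norm_cast
  have e3 : (2:ℝ) ^ (3 * k) = ((2:ℝ) ^ k) ^ 3 := by rw [mul_comm, zpow_mul]; norm_cast
  rw [e2, e3]
  unfold xtNorm
  have hn : ‖(4 * π * ((((2:ℝ) ^ k) ^ 3 : ℝ) : ℂ) : ℂ)‖ = 4 * π * ((2:ℝ) ^ k) ^ 3 := by
    rw [norm_mul, norm_mul, Complex.norm_real, Complex.norm_real, Real.norm_of_nonneg Real.pi_pos.le,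
      Real.norm_of_nonneg (by positivity)]
    simp
  rw [norm_mul, hn]
  calc _ ≤ 4 * π * ((2:ℝ) ^ k) ^ 3 * (C * (1 + ((2:ℝ) ^ k) ^ 2 * √(‖x‖ ^ 2 + t ^ 2)) ^ (-(3 / 2) : ℝ)) :=
        mul_le_mul_of_nonneg_left h (by positivity)
    _ = _ := by ring

end
end
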